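/- arXiv:1808.08231 — 2 statements merged into one kernel-verified Lean document; each statement's English description precedes it below -/
import Mathlib

section
/- Classical Entropy Power Inequality: Let X and Y be independent random variables with values in ℝⁿ, each with a probability density with respect to Lebesgue measure, finite second moments and finite differential entropies S(X), S(Y), and such that S(X+Y) is finite. Then exp(2S(X+Y)/n) ≥ exp(2S(X)/n) + exp(2S(Y)/n). -/
open MeasureTheory ProbabilityTheory Real Filter

noncomputable section

/-- The differential entropy `-∫ p ln p` of a measure `μ` with density `p = dμ/dν` with
respect to the reference measure `ν`. -/
def diffEntropy {α : Type*} [MeasurableSpace α] (ν μ : Measure α) : ℝ :=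
  -∫ x, (μ.rnDeriv ν x).toReal * Real.log ((μ.rnDeriv ν x).toReal) ∂ν

/-- The differential entropy of `μ` relative to `ν` is finite, i.e. the integrand
`p ln p` is integrable. -/
def HasFiniteEntropy {α : Type*} [MeasurableSpace α] (ν μ : Measure α) : Prop :=
  Integrable (fun x => (μ.rnDeriv ν x).toReal * Real.log ((μ.rnDeriv ν x).toReal)) ν

section helpers

open scoped ENNReal

lemma epi_cdf_deriv (f : ℝ → ℝ≥0∞) (hf : Measurable f) (h1 : ∫⁻ t, f t = 1) :
    ∀ᵐ t, HasDerivAt (cdf (volume.withDensity f)) (f t).toReal t := by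
  have : IsProbabilityMeasure (volume.withDensity f) := ⟨by simp [withDensity_apply, h1]⟩
  have h2 := (cdf (volume.withDensity f)).ae_hasDerivAt
  rw [measure_cdf] at h2
  filter_upwards [h2, Measure.rnDeriv_withDensity volume hf] with t ht hr
  rwa [hr] at ht

lemma epi_cdf_cont (μ : Measure ℝ) [IsProbabilityMeasure μ] (h : μ ≪ volume) :
    Continuous (cdf μ) := by
  rw [continuous_iff_continuousAt]
  intro x
  rw [(cdf μ).mono.continuousAt_iff_leftLim_eq_rightLim, StieltjesFunction.rightLim_eq]
  have h1 : (cdf μ).measure {x} = 0 := by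
    rw [measure_cdf]; exact h (by simp)
  rw [StieltjesFunction.measure_singleton, ENNReal.ofReal_eq_zero] at h1
  exact le_antisymm ((cdf μ).mono.leftLim_le le_rfl) (by linarith)

/-- one-dimensional monotone transport, with parameters -/
lemma epi_transport1 {A : Type} [MeasurableSpace A] (f : A → ℝ → ℝ≥0∞)
    (hf : Measurable (Function.uncurry f)) (h1 : ∀ a, ∫⁻ t, f a t = 1) :
    ∃ T : A → ℝ → ℝ, Measurable (Function.uncurry T) ∧ (∀ a, StrictMono (T a)) ∧
      (∀ a, (gaussianReal 0 1).map (T a) = volume.withDensity (f a)) ∧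
      ∀ a, ∀ᵐ x, 0 < (f a (T a x)).toReal ∧
        HasDerivAt (T a) (gaussianPDFReal 0 1 x / (f a (T a x)).toReal) x := by
  have hfa : ∀ a, Measurable (f a) := fun a => hf.comp measurable_prodMk_left
  have hP : ∀ a, IsProbabilityMeasure (volume.withDensity (f a)) :=
    fun a => ⟨by simp [withDensity_apply, h1]⟩
  set μ : A → Measure ℝ := fun a => volume.withDensity (f a) with hμ
  have hac : ∀ a, μ a ≪ volume := fun a => withDensity_absolutelyContinuous _ _
  have hFc : ∀ a, Continuous (cdf (μ a)) := fun a => epi_cdf_cont _ (hac a)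
  have hv : (1 : NNReal) ≠ 0 := one_ne_zero
  have hgac := gaussianReal_absolutelyContinuous 0 hv
  have hgac' := gaussianReal_absolutelyContinuous' 0 hv
  set Φ := cdf (gaussianReal 0 1) with hΦ
  have hΦc : Continuous Φ := epi_cdf_cont _ hgac
  have hΦs : StrictMono Φ := by
    intro x y hxy
    have h2 : 0 < Φ.measure (Set.Ioc x y) := by
      rw [hΦ, measure_cdf]
      refine pos_iff_ne_zero.2 fun h0 => ?_
      have := hgac' h0
      simp at this
      linarith
    rw [StieltjesFunction.measure_Ioc, ENNReal.ofReal_pos] at h2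
    linarith
  have hΦ0 : ∀ x, 0 < Φ x := fun x =>
    lt_of_le_of_lt (cdf_nonneg _ (x-1)) (hΦs (by linarith))
  have hΦ1 : ∀ x, Φ x < 1 := fun x =>
    lt_of_lt_of_le (hΦs (by linarith)) (cdf_le_one _ (x+1))
  let S : A → ℝ → Set ℝ := fun a x => {t | Φ x ≤ cdf (μ a) t}
  let T : A → ℝ → ℝ := fun a x => sInf (S a x)
  have hSne : ∀ a x, (S a x).Nonempty := by
    intro a x
    have := (tendsto_cdf_atTop (μ a)).eventually (lt_mem_nhds (hΦ1 x))
    obtain ⟨t, ht⟩ := this.exists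
    exact ⟨t, ht.le⟩
  have hSb : ∀ a x, BddBelow (S a x) := by
    intro a x
    have := (tendsto_cdf_atBot (μ a)).eventually (gt_mem_nhds (hΦ0 x))
    obtain ⟨t, ht⟩ := this.exists
    refine ⟨t, fun s hs => ?_⟩
    by_contra hlt
    push Not at hlt
    have h3 := (cdf (μ a)).mono hlt.le
    have h4 : Φ x ≤ cdf (μ a) s := hs
    linarith
  have hScl : ∀ a x, IsClosed (S a x) := fun a x => isClosed_le continuous_const (hFc a)
  have hmem : ∀ a x, T a x ∈ S a x := fun a x => (hScl a x).csInf_mem (hSne a x) (hSb a x)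
  have hgal : ∀ a x t, T a x ≤ t ↔ Φ x ≤ cdf (μ a) t := by
    intro a x t
    constructor
    · intro h
      exact (hmem a x).trans ((cdf (μ a)).mono h)
    · intro h
      exact csInf_le (hSb a x) h
  have hFT : ∀ a x, cdf (μ a) (T a x) = Φ x := by
    intro a x
    refine le_antisymm ?_ (hmem a x)
    refine le_of_tendsto ((hFc a).continuousAt.mono_left nhdsWithin_le_nhds : Tendsto _ (nhdsWithin (T a x) (Set.Iio (T a x))) _) ?_
    filter_upwards [self_mem_nhdsWithin] with t ht
    by_contra hlt
    push Not at hlt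
    exact absurd ((hgal a x t).2 hlt.le) (not_le.2 ht)
  have hTs : ∀ a, StrictMono (T a) := by
    intro a x y hxy
    by_contra hlt
    push Not at hlt
    have h3 := (cdf (μ a)).mono hlt
    rw [hFT, hFT] at h3
    exact absurd (hΦs hxy) (not_lt.2 h3)
  have hFm : ∀ t, Measurable fun a => cdf (μ a) t := by
    intro t
    have : (fun a => cdf (μ a) t) = fun a => (∫⁻ s in Set.Iic t, f a s).toReal := by
      ext a
      rw [cdf_eq_real, Measure.real, withDensity_apply _ measurableSet_Iic]
    rw [this]
    exact (Measurable.lintegral_prod_right' (f := Function.uncurry f) hf).ennreal_toReal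
  have hTm : Measurable (Function.uncurry T) := by
    refine measurable_of_Iic fun t => ?_
    have : Function.uncurry T ⁻¹' Set.Iic t = {p | Φ p.2 ≤ cdf (μ p.1) t} := by
      ext ⟨a, x⟩
      exact hgal a x t
    rw [this]
    exact measurableSet_le (hΦc.measurable.comp measurable_snd) ((hFm t).comp measurable_fst)
  have hTam : ∀ a, Measurable (T a) := fun a => hTm.comp measurable_prodMk_left
  have hpush : ∀ a, (gaussianReal 0 1).map (T a) = μ a := by
    intro a
    have := hP a
    refine Measure.ext_of_Iic _ _ fun t => ?_
    rw [Measure.map_apply (hTam a) measurableSet_Iic]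
    have : T a ⁻¹' Set.Iic t = {x | Φ x ≤ cdf (μ a) t} := by
      ext x; exact hgal a x t
    rw [this, ← ofReal_cdf (μ a)]
    rcases (cdf_nonneg (μ a) t).eq_or_lt with h0 | h0
    · rw [← h0]
      have : {x | Φ x ≤ 0} = ∅ := by
        ext x; simp [hΦ0 x]
      simp [this]
    rcases (cdf_le_one (μ a) t).eq_or_lt with h2 | h2
    · rw [h2]
      have : {x | Φ x ≤ 1} = Set.univ := by
        ext x; simp [(hΦ1 x).le]
      simp [this]
    have := mem_range_of_exists_le_of_exists_ge hΦc
      (((tendsto_cdf_atBot (gaussianReal 0 1)).eventually (gt_mem_nhds h0)).exists.imp fun _ h => h.le)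
      (((tendsto_cdf_atTop (gaussianReal 0 1)).eventually (lt_mem_nhds h2)).exists.imp fun _ h => h.le)
    obtain ⟨x0, hx0⟩ := this
    rw [← hx0]
    have : {x | Φ x ≤ Φ x0} = Set.Iic x0 := by
      ext x; simp [hΦs.le_iff_le]
    rw [this, ofReal_cdf]
  refine ⟨T, hTm, hTs, hpush, fun a => ?_⟩
  have hA := (hTs a).monotone.ae_differentiableAt
  have hB : ∀ᵐ x, HasDerivAt Φ (gaussianPDFReal 0 1 x) x := by
    have := epi_cdf_deriv (gaussianPDF 0 1) (measurable_gaussianPDF 0 1) (lintegral_gaussianPDF_eq_one 0 hv)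
    rw [← gaussianReal_of_var_ne_zero 0 hv] at this
    simpa [toReal_gaussianPDF] using this
  have hC : ∀ᵐ x, HasDerivAt (cdf (μ a)) (f a (T a x)).toReal (T a x) := by
    have h5 := (hac a).ae_le (epi_cdf_deriv (f a) (hfa a) (h1 a))
    have h6 : ∀ᵐ t ∂((gaussianReal 0 1).map (T a)), HasDerivAt (cdf (μ a)) (f a t).toReal t := by
      rw [hpush a]; exact h5
    exact hgac'.ae_le (ae_of_ae_map (hTam a).aemeasurable h6)
  filter_upwards [hA, hB, hC] with x hx1 hx2 hx3
  have h7 := hx3.comp x hx1.hasDerivAt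
  have h8 : (cdf (μ a)) ∘ T a = Φ := by ext x; exact hFT a x
  rw [h8] at h7
  have h9 := h7.unique hx2
  have hpos := gaussianPDFReal_pos 0 1 x hv
  have h10 : (f a (T a x)).toReal ≠ 0 := by
    intro h0
    rw [h0, zero_mul] at h9
    linarith
  refine ⟨lt_of_le_of_ne ENNReal.toReal_nonneg (Ne.symm h10), ?_⟩
  rw [← h9, mul_div_cancel_left₀ _ h10]
  exact hx1.hasDerivAt

lemma epi_gauss_exp (x : ℝ) :
    gaussianPDFReal 0 1 x = Real.exp (- x ^ 2 / 2 - Real.log (Real.sqrt (2 * π))) := by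
  have h : 0 < Real.sqrt (2 * π) := by positivity
  rw [Real.exp_sub, Real.exp_log h, gaussianPDFReal]
  simp
  field_simp

lemma epi_pointwise (a b : ℝ) (ha : 0 < a) (hb : 0 < b) (hab : a ^ 2 + b ^ 2 = 1)
    (x y F G : ℝ) (hF : 0 < F) (hG : 0 < G) :
    gaussianPDFReal 0 1 x * gaussianPDFReal 0 1 y * F ^ (-a ^ 2) * G ^ (-b ^ 2)
        * Real.exp (a * b * (x * y)) ≤
      (a ^ (a ^ 2) * b ^ (b ^ 2)) * (gaussianPDFReal 0 1 (a * y - b * x) *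
        (a * (gaussianPDFReal 0 1 x / F) + b * (gaussianPDFReal 0 1 y / G))) := by
  have hx := gaussianPDFReal_pos 0 1 x one_ne_zero
  have hy := gaussianPDFReal_pos 0 1 y one_ne_zero
  have hv := gaussianPDFReal_pos 0 1 (a * y - b * x) one_ne_zero
  have h1 := Real.geom_mean_le_arith_mean2_weighted (sq_nonneg a) (sq_nonneg b)
    (p₁ := gaussianPDFReal 0 1 x / (F * a)) (p₂ := gaussianPDFReal 0 1 y / (G * b))
    (by positivity) (by positivity) hab
  have h2 : a ^ 2 * (gaussianPDFReal 0 1 x / (F * a)) + b ^ 2 * (gaussianPDFReal 0 1 y / (G * b))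
      = a * (gaussianPDFReal 0 1 x / F) + b * (gaussianPDFReal 0 1 y / G) := by
    field_simp
  rw [h2] at h1
  refine le_trans (le_of_eq ?_) (mul_le_mul_of_nonneg_left (mul_le_mul_of_nonneg_left h1 hv.le)
    (by positivity))
  rw [Real.div_rpow hx.le (by positivity), Real.div_rpow hy.le (by positivity),
    Real.mul_rpow hF.le ha.le, Real.mul_rpow hG.le hb.le, Real.rpow_neg hF.le, Real.rpow_neg hG.le]
  have h3 : gaussianPDFReal 0 1 x * gaussianPDFReal 0 1 y * Real.exp (a * b * (x * y)) =
      gaussianPDFReal 0 1 (a * y - b * x) *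
        (gaussianPDFReal 0 1 x ^ (a ^ 2) * gaussianPDFReal 0 1 y ^ (b ^ 2)) := by
    simp only [epi_gauss_exp]
    rw [← Real.exp_mul, ← Real.exp_mul, ← Real.exp_add, ← Real.exp_add, ← Real.exp_add,
      ← Real.exp_add]
    congr 1
    have hb2 : b ^ 2 = 1 - a ^ 2 := by linarith
    ring_nf
    rw [hb2]
    ring
  have p1 : 0 < F ^ (a ^ 2) := by positivity
  have p2 : 0 < G ^ (b ^ 2) := by positivity
  have p3 : 0 < a ^ (a ^ 2) := by positivity
  have p4 : 0 < b ^ (b ^ 2) := by positivity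
  generalize Real.exp (a * b * (x * y)) = E at *
  generalize F ^ (a ^ 2) = q1 at *
  generalize G ^ (b ^ 2) = q2 at *
  generalize a ^ (a ^ 2) = q3 at *
  generalize b ^ (b ^ 2) = q4 at *
  field_simp
  linear_combination h3

lemma epi_rotation (a b : ℝ) (hab : a ^ 2 + b ^ 2 = 1) :
    MeasurePreserving (fun p : ℝ × ℝ => (a * p.1 - b * p.2, b * p.1 + a * p.2))
      (volume.prod volume) (volume.prod volume) := by
  have hn : ‖(⟨a, b⟩ : ℂ)‖ = 1 := by
    rw [Complex.norm_def, Complex.normSq_mk, ← sq, ← sq, hab, Real.sqrt_one]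
  let c : Circle := ⟨⟨a, b⟩, mem_sphere_zero_iff_norm.2 hn⟩
  have h1 := (rotation c).measurePreserving
  have h2 := Complex.volume_preserving_equiv_real_prod
  have h3 := (h2.comp h1).comp h2.symm
  have hc1 : (c : ℂ).re = a := rfl
  have hc2 : (c : ℂ).im = b := rfl
  have h4 : (fun p : ℝ × ℝ => (a * p.1 - b * p.2, b * p.1 + a * p.2)) =
      ((Complex.measurableEquivRealProd ∘ (rotation c)) ∘ Complex.measurableEquivRealProd.symm) := by
    clear_value c
    ext p
    · simp [rotation_apply, Complex.measurableEquivRealProd, hc1, hc2]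
    · simp [rotation_apply, Complex.measurableEquivRealProd, hc1, hc2]; ring
  rw [h4]
  exact h3

lemma epi_change (Θ Θ' : ℝ → ℝ) (hΘ : StrictMono Θ) (hd : ∀ᵐ u, HasDerivAt Θ (Θ' u) u)
    (r : ℝ → ℝ≥0∞) : ∫⁻ u, r (Θ u) * ENNReal.ofReal (Θ' u) ≤ ∫⁻ z, r z := by
  obtain ⟨s, hs, hsm, hsn⟩ := exists_measurable_superset_of_null (ae_iff.1 hd)
  have h1 := lintegral_image_eq_lintegral_abs_deriv_mul hsm.compl (f := Θ) (f' := Θ')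
    (fun x hx => by
      have : HasDerivAt Θ (Θ' x) x := by
        by_contra h
        exact hx (hs h)
      exact this.hasDerivWithinAt) hΘ.injective.injOn r
  calc ∫⁻ u, r (Θ u) * ENNReal.ofReal (Θ' u)
      ≤ ∫⁻ u, ENNReal.ofReal |Θ' u| * r (Θ u) := by
        refine lintegral_mono fun u => ?_
        rw [mul_comm]
        gcongr
        exact le_abs_self _
    _ = ∫⁻ u in sᶜ, ENNReal.ofReal |Θ' u| * r (Θ u) := by
        rw [Measure.restrict_eq_self_of_ae_mem]
        exact measure_eq_zero_iff_ae_notMem.1 hsn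
    _ = _ := h1.symm
    _ ≤ _ := setLIntegral_le_lintegral _ _

lemma epi_ineq1 (a b : ℝ) (ha : 0 < a) (hb : 0 < b) (hab : a ^ 2 + b ^ 2 = 1)
    (f g : ℝ → ℝ≥0∞) (hf : Measurable f) (hg : Measurable g) (T U : ℝ → ℝ)
    (hT : Measurable T) (hU : Measurable U) (hTs : StrictMono T) (hUs : StrictMono U)
    (hTd : ∀ᵐ x, 0 < (f (T x)).toReal ∧
        HasDerivAt T (gaussianPDFReal 0 1 x / (f (T x)).toReal) x)
    (hUd : ∀ᵐ x, 0 < (g (U x)).toReal ∧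
        HasDerivAt U (gaussianPDFReal 0 1 x / (g (U x)).toReal) x)
    (r : ℝ → ℝ≥0∞) (hr : Measurable r) :
    ∫⁻ x, ∫⁻ y, r (T x + U y) * f (T x) ^ (-a ^ 2) * g (U y) ^ (-b ^ 2) *
      ENNReal.ofReal (Real.exp (a * b * (x * y))) ∂(gaussianReal 0 1) ∂(gaussianReal 0 1)
      ≤ ENNReal.ofReal (a ^ (a ^ 2) * b ^ (b ^ 2)) * ∫⁻ z, r z := by
  set H : ℝ × ℝ → ℝ≥0∞ := fun p => r (T p.1 + U p.2) * f (T p.1) ^ (-a ^ 2) *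
    g (U p.2) ^ (-b ^ 2) * ENNReal.ofReal (Real.exp (a * b * (p.1 * p.2))) with hH
  have hHm : Measurable H := by fun_prop
  have hφm := measurable_gaussianPDF 0 1
  set R : ℝ × ℝ → ℝ × ℝ := fun p => (a * p.1 - b * p.2, b * p.1 + a * p.2) with hR
  have hRp : MeasurePreserving R (volume.prod volume) (volume.prod volume) := epi_rotation a b hab
  set C := ENNReal.ofReal (a ^ (a ^ 2) * b ^ (b ^ 2)) with hC
  set J : ℝ × ℝ → ℝ := fun p => a * (gaussianPDFReal 0 1 p.1 / (f (T p.1)).toReal) +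
    b * (gaussianPDFReal 0 1 p.2 / (g (U p.2)).toReal) with hJ
  have hJm : Measurable J := by
    have := measurable_gaussianPDFReal 0 1
    fun_prop
  have hpt : ∀ᵐ p : ℝ × ℝ ∂(volume.prod volume), gaussianPDF 0 1 p.1 * gaussianPDF 0 1 p.2 * H p ≤
      C * (gaussianPDF 0 1 (a * p.2 - b * p.1) * (r (T p.1 + U p.2) * ENNReal.ofReal (J p))) := by
    have h1 := (Measure.quasiMeasurePreserving_fst (μ := (volume : Measure ℝ)) (ν := (volume : Measure ℝ))).ae hTd
    have h2 := (Measure.quasiMeasurePreserving_snd (μ := (volume : Measure ℝ)) (ν := (volume : Measure ℝ))).ae hUd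
    filter_upwards [h1, h2] with p hp1 hp2
    obtain ⟨hp1, -⟩ := hp1
    obtain ⟨hp2, -⟩ := hp2
    have key := epi_pointwise a b ha hb hab p.1 p.2 _ _ hp1 hp2
    have e1 : f (T p.1) = ENNReal.ofReal (f (T p.1)).toReal :=
      (ENNReal.ofReal_toReal (fun h => by simp [h] at hp1)).symm
    have e2 : g (U p.2) = ENNReal.ofReal (g (U p.2)).toReal :=
      (ENNReal.ofReal_toReal (fun h => by simp [h] at hp2)).symm
    have n1 := gaussianPDFReal_nonneg 0 1 p.1
    have n2 := gaussianPDFReal_nonneg 0 1 p.2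
    have n3 := gaussianPDFReal_nonneg 0 1 (a * p.2 - b * p.1)
    have key2 := ENNReal.ofReal_le_ofReal key
    rw [ENNReal.ofReal_mul (by positivity), ENNReal.ofReal_mul (by positivity),
      ENNReal.ofReal_mul (by positivity), ENNReal.ofReal_mul (by positivity),
      ENNReal.ofReal_mul (p := a ^ (a ^ 2) * b ^ (b ^ 2)) (by positivity), ENNReal.ofReal_mul n3,
      ← ENNReal.ofReal_rpow_of_pos hp1, ← ENNReal.ofReal_rpow_of_pos hp2, ← e1, ← e2] at key2
    calc gaussianPDF 0 1 p.1 * gaussianPDF 0 1 p.2 * H p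
        = r (T p.1 + U p.2) * (gaussianPDF 0 1 p.1 * gaussianPDF 0 1 p.2 * f (T p.1) ^ (-a ^ 2) *
          g (U p.2) ^ (-b ^ 2) * ENNReal.ofReal (Real.exp (a * b * (p.1 * p.2)))) := by
          rw [hH]; ring
      _ ≤ r (T p.1 + U p.2) * (C * (gaussianPDF 0 1 (a * p.2 - b * p.1) * ENNReal.ofReal (J p))) := by
          exact mul_le_mul_right key2 _
      _ = _ := by ring
  have hder : ∀ᵐ p : ℝ × ℝ ∂(volume.prod volume), HasDerivAt T (gaussianPDFReal 0 1 p.1 / (f (T p.1)).toReal) p.1 ∧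
      HasDerivAt U (gaussianPDFReal 0 1 p.2 / (g (U p.2)).toReal) p.2 := by
    have h1 := (Measure.quasiMeasurePreserving_fst (μ := (volume : Measure ℝ)) (ν := (volume : Measure ℝ))).ae hTd
    have h2 := (Measure.quasiMeasurePreserving_snd (μ := (volume : Measure ℝ)) (ν := (volume : Measure ℝ))).ae hUd
    filter_upwards [h1, h2] with p hp1 hp2 using ⟨hp1.2, hp2.2⟩
  have hder2 : ∀ᵐ v, ∀ᵐ u, HasDerivAt T (gaussianPDFReal 0 1 (a * u - b * v) / (f (T (a * u - b * v))).toReal) (a * u - b * v) ∧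
      HasDerivAt U (gaussianPDFReal 0 1 (b * u + a * v) / (g (U (b * u + a * v))).toReal) (b * u + a * v) := by
    have h1 := hRp.quasiMeasurePreserving.ae hder
    have h2 := (Measure.measurePreserving_swap (μ := (volume : Measure ℝ)) (ν := (volume : Measure ℝ))).quasiMeasurePreserving.ae h1
    exact Measure.ae_ae_of_ae_prod h2
  calc ∫⁻ x, ∫⁻ y, H (x, y) ∂(gaussianReal 0 1) ∂(gaussianReal 0 1)
      = ∫⁻ x, ∫⁻ y, gaussianPDF 0 1 x * gaussianPDF 0 1 y * H (x, y) := by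
        rw [gaussianReal_of_var_ne_zero 0 one_ne_zero,
          lintegral_withDensity_eq_lintegral_mul _ hφm
            (Measurable.lintegral_prod_right' hHm)]
        refine lintegral_congr fun x => ?_
        have hHx : Measurable fun y => H (x, y) := hHm.comp measurable_prodMk_left
        rw [Pi.mul_apply, lintegral_withDensity_eq_lintegral_mul _ hφm hHx, ← lintegral_const_mul]
        · refine lintegral_congr fun y => ?_
          simp [mul_assoc]
        · exact hφm.mul (hHm.comp measurable_prodMk_left)
    _ = ∫⁻ p : ℝ × ℝ, gaussianPDF 0 1 p.1 * gaussianPDF 0 1 p.2 * H p ∂(volume.prod volume) := by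
        rw [lintegral_prod]
        fun_prop
    _ ≤ ∫⁻ p : ℝ × ℝ, C * (gaussianPDF 0 1 (a * p.2 - b * p.1) * (r (T p.1 + U p.2) * ENNReal.ofReal (J p))) ∂(volume.prod volume) :=
        lintegral_mono_ae hpt
    _ = ∫⁻ q : ℝ × ℝ, C * (gaussianPDF 0 1 (a * (R q).2 - b * (R q).1) * (r (T (R q).1 + U (R q).2) * ENNReal.ofReal (J (R q)))) ∂(volume.prod volume) := by
        rw [hRp.lintegral_comp (f := fun p : ℝ × ℝ => C * (gaussianPDF 0 1 (a * p.2 - b * p.1) * (r (T p.1 + U p.2) * ENNReal.ofReal (J p))))]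
        fun_prop
    _ = ∫⁻ q : ℝ × ℝ, C * (gaussianPDF 0 1 q.2 * (r (T (R q).1 + U (R q).2) * ENNReal.ofReal (J (R q)))) ∂(volume.prod volume) := by
        refine lintegral_congr fun q => ?_
        congr 3
        simp only [hR]
        linear_combination q.2 * hab
    _ = ∫⁻ v, ∫⁻ u, C * (gaussianPDF 0 1 v * (r (T (a * u - b * v) + U (b * u + a * v)) * ENNReal.ofReal (J (a * u - b * v, b * u + a * v)))) := by
        rw [lintegral_prod_symm']
        fun_prop
    _ = C * ∫⁻ v, gaussianPDF 0 1 v * ∫⁻ u, (r (T (a * u - b * v) + U (b * u + a * v)) * ENNReal.ofReal (J (a * u - b * v, b * u + a * v))) := by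
        rw [← lintegral_const_mul']
        · refine lintegral_congr fun v => ?_
          rw [lintegral_const_mul' _ _ ENNReal.ofReal_ne_top, lintegral_const_mul' _ _ gaussianPDF_ne_top]
        · exact ENNReal.ofReal_ne_top
    _ ≤ C * ∫⁻ v, gaussianPDF 0 1 v * ∫⁻ z, r z := by
        refine mul_le_mul_right (lintegral_mono_ae ?_) _
        filter_upwards [hder2] with v hv
        refine mul_le_mul_right ?_ _
        refine epi_change (fun u => T (a * u - b * v) + U (b * u + a * v))
          (fun u => J (a * u - b * v, b * u + a * v)) ?_ ?_ r
        · intro u w huw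
          exact add_lt_add (hTs (by nlinarith)) (hUs (by nlinarith))
        · filter_upwards [hv] with u hu
          have d1 : HasDerivAt (fun u : ℝ => a * u - b * v) a u := by
            simpa using ((hasDerivAt_id u).const_mul a).sub_const (b * v)
          have d2 : HasDerivAt (fun u : ℝ => b * u + a * v) b u := by
            simpa using ((hasDerivAt_id u).const_mul b).add_const (a * v)
          have := (hu.1.comp u d1).add (hu.2.comp u d2)
          refine this.congr_deriv ?_
          simp only [hJ]
          ring
    _ = C * ∫⁻ z, r z := by
        rw [lintegral_mul_const _ hφm, lintegral_gaussianPDF_eq_one 0 one_ne_zero, one_mul]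

/-- Transport property of a measured additive space, closed under products. -/
def EpiTP (a b : ℝ) (E : Type) [MeasurableSpace E] [Add E] (ν : Measure E) (C : ℝ≥0∞) : Prop :=
  (∃ h : E → ℝ≥0∞, Measurable h ∧ ∫⁻ x, h x ∂ν = 1) ∧
  ∃ (G : Type) (_ : MeasurableSpace G) (γ : Measure G) (k : G × G → ℝ),
    IsProbabilityMeasure γ ∧ Measurable k ∧ Integrable k (γ.prod γ) ∧ ∫ p, k p ∂(γ.prod γ) = 0 ∧
    ∀ (A B : Type) [MeasurableSpace A] [MeasurableSpace B] (f : A → E → ℝ≥0∞) (g : B → E → ℝ≥0∞),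
      Measurable (Function.uncurry f) → Measurable (Function.uncurry g) →
      (∀ s, ∫⁻ x, f s x ∂ν = 1) → (∀ s, ∫⁻ x, g s x ∂ν = 1) →
      ∃ (T : A → G → E) (U : B → G → E),
        Measurable (Function.uncurry T) ∧ Measurable (Function.uncurry U) ∧
        (∀ s, γ.map (T s) = ν.withDensity (f s)) ∧ (∀ s, γ.map (U s) = ν.withDensity (g s)) ∧
        ∀ s t (r : E → ℝ≥0∞), Measurable r →
          ∫⁻ x, ∫⁻ y, r (T s x + U t y) * f s (T s x) ^ (-a ^ 2) * g t (U t y) ^ (-b ^ 2) *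
            ENNReal.ofReal (Real.exp (k (x, y))) ∂γ ∂γ ≤ C * ∫⁻ z, r z ∂ν

lemma epiTP_real (a b : ℝ) (ha : 0 < a) (hb : 0 < b) (hab : a ^ 2 + b ^ 2 = 1) :
    EpiTP a b ℝ volume (ENNReal.ofReal (a ^ (a ^ 2) * b ^ (b ^ 2))) := by
  have hi : Integrable (fun x : ℝ => x) (gaussianReal 0 1) := by
    have := (memLp_id_gaussianReal (μ := 0) (v := 1) 1)
    exact memLp_one_iff_integrable.1 this
  refine ⟨⟨gaussianPDF 0 1, measurable_gaussianPDF 0 1, lintegral_gaussianPDF_eq_one 0 one_ne_zero⟩,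
    ℝ, inferInstance, gaussianReal 0 1, fun p => a * b * (p.1 * p.2), inferInstance, by fun_prop,
    (hi.mul_prod hi).const_mul _, ?_, ?_⟩
  · rw [integral_const_mul, integral_prod_mul (fun x : ℝ => x) (fun x : ℝ => x)]
    simp
  · intro A B _ _ f g hf hg hf1 hg1
    obtain ⟨T, hT, hTs, hTp, hTd⟩ := epi_transport1 f hf hf1
    obtain ⟨U, hU, hUs, hUp, hUd⟩ := epi_transport1 g hg hg1
    refine ⟨T, U, hT, hU, hTp, hUp, fun s t r hr => ?_⟩
    exact epi_ineq1 a b ha hb hab (f s) (g t) (hf.comp measurable_prodMk_left)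
      (hg.comp measurable_prodMk_left) (T s) (U t) (hT.comp measurable_prodMk_left)
      (hU.comp measurable_prodMk_left) (hTs s) (hUs t) (hTd s) (hUd t) r hr

lemma epiTP_transfer {a b : ℝ} {E E' : Type} [MeasurableSpace E] [Add E] [MeasurableSpace E']
    [Add E'] {ν : Measure E} {ν' : Measure E'} {C : ℝ≥0∞} (h : EpiTP a b E ν C) (e : E ≃ᵐ E')
    (he : MeasurePreserving e ν ν') (hadd : ∀ x y, e (x + y) = e x + e y) :
    EpiTP a b E' ν' C := by
  obtain ⟨⟨h0, h0m, h01⟩, G, mG, γ, k, hγ, hkm, hki, hk0, H⟩ := h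
  refine ⟨⟨h0 ∘ e.symm, h0m.comp e.symm.measurable, ?_⟩, G, mG, γ, k, hγ, hkm, hki, hk0, ?_⟩
  · rw [← he.lintegral_comp_emb e.measurableEmbedding]
    simpa using h01
  intro A B _ _ f g hf hg hf1 hg1
  obtain ⟨T, U, hT, hU, hTp, hUp, hTU⟩ := H A B (fun s x => f s (e x)) (fun s x => g s (e x))
    (hf.comp (measurable_fst.prodMk (e.measurable.comp measurable_snd)))
    (hg.comp (measurable_fst.prodMk (e.measurable.comp measurable_snd)))
    (fun s => by rw [← hf1 s, he.lintegral_comp_emb e.measurableEmbedding])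
    (fun s => by rw [← hg1 s, he.lintegral_comp_emb e.measurableEmbedding])
  have aux : ∀ f : E' → ℝ≥0∞, (ν.withDensity (fun x => f (e x))).map e = ν'.withDensity f := by
    intro f
    ext s hs
    rw [Measure.map_apply e.measurable hs, withDensity_apply _ hs,
      withDensity_apply _ (e.measurable hs), he.setLIntegral_comp_preimage_emb e.measurableEmbedding]
  refine ⟨fun s x => e (T s x), fun s x => e (U s x), e.measurable.comp hT, e.measurable.comp hU,
    fun s => ?_, fun s => ?_, fun s t r hr => ?_⟩
  · have hTs : Measurable (T s) := hT.comp measurable_prodMk_left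
    rw [← aux, ← hTp, Measure.map_map e.measurable hTs]; rfl
  · have hUs : Measurable (U s) := hU.comp measurable_prodMk_left
    rw [← aux, ← hUp, Measure.map_map e.measurable hUs]; rfl
  · have := hTU s t (fun x => r (e x)) (hr.comp e.measurable)
    rw [he.lintegral_comp_emb e.measurableEmbedding] at this
    simpa [hadd] using this

lemma epiTP_zero (a b : ℝ) : EpiTP a b (Fin 0 → ℝ) volume 1 := by
  have hv : (volume : Measure (Fin 0 → ℝ)) = Measure.dirac 0 := Measure.volume_pi_eq_dirac 0
  rw [hv]
  refine ⟨⟨1, measurable_one, by simp⟩, Unit, inferInstance, Measure.dirac (), 0,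
    inferInstance, measurable_zero, integrable_zero _ _ _, by simp, ?_⟩
  intro A B _ _ f g hf hg hf1 hg1
  refine ⟨fun _ _ => 0, fun _ _ => 0, measurable_const, measurable_const, fun s => ?_, fun s => ?_,
    fun s t r hr => ?_⟩
  · have : f s = 1 := by
      ext x
      have := hf1 s
      rw [lintegral_dirac] at this
      rw [Subsingleton.elim x 0, this]; rfl
    rw [this, withDensity_one, Measure.map_dirac]
  · have : g s = 1 := by
      ext x
      have := hg1 s
      rw [lintegral_dirac] at this
      rw [Subsingleton.elim x 0, this]; rfl
    rw [this, withDensity_one, Measure.map_dirac]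
  · have h1 := hf1 s
    have h2 := hg1 t
    rw [lintegral_dirac] at h1 h2
    simp only [lintegral_dirac, add_zero, h1, h2, ENNReal.one_rpow, mul_one, Pi.zero_apply,
      Real.exp_zero, ENNReal.ofReal_one, one_mul, le_refl]

section prod
variable {A E₁ E₂ : Type} [MeasurableSpace A] [MeasurableSpace E₁] [MeasurableSpace E₂]

/-- marginal density -/
def epiMarg (ν₂ : Measure E₂) (f : A → E₁ × E₂ → ℝ≥0∞) (s : A) (x : E₁) : ℝ≥0∞ :=
  ∫⁻ y, f s (x, y) ∂ν₂

open Classical in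
/-- conditional density -/
def epiCond (ν₂ : Measure E₂) (h : E₂ → ℝ≥0∞) (f : A → E₁ × E₂ → ℝ≥0∞) (p : A × E₁) (y : E₂) :
    ℝ≥0∞ :=
  if epiMarg ν₂ f p.1 p.2 = 0 ∨ epiMarg ν₂ f p.1 p.2 = ⊤ then h y
  else f p.1 (p.2, y) / epiMarg ν₂ f p.1 p.2

lemma epiMarg_meas (ν₂ : Measure E₂) [SFinite ν₂] (f : A → E₁ × E₂ → ℝ≥0∞)
    (hf : Measurable (Function.uncurry f)) : Measurable (Function.uncurry (epiMarg ν₂ f)) := by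
  refine Measurable.lintegral_prod_right' (ν := ν₂)
    (f := fun q : (A × E₁) × E₂ => f q.1.1 (q.1.2, q.2)) ?_
  exact hf.comp (by fun_prop : Measurable fun q : (A × E₁) × E₂ => (q.1.1, (q.1.2, q.2)))

lemma epiCond_meas (ν₂ : Measure E₂) [SFinite ν₂] (h : E₂ → ℝ≥0∞) (hh : Measurable h)
    (f : A → E₁ × E₂ → ℝ≥0∞) (hf : Measurable (Function.uncurry f)) :
    Measurable (Function.uncurry (epiCond ν₂ h f)) := by
  have hm := epiMarg_meas ν₂ f hf
  have hm' : Measurable (fun q : (A × E₁) × E₂ => epiMarg ν₂ f q.1.1 q.1.2) :=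
    hm.comp measurable_fst
  refine Measurable.ite ?_ (hh.comp measurable_snd) (Measurable.div ?_ hm')
  · exact (hm' (measurableSet_singleton 0)).union (hm' (measurableSet_singleton ⊤))
  · exact hf.comp (by fun_prop : Measurable fun q : (A × E₁) × E₂ => (q.1.1, (q.1.2, q.2)))

lemma epiCond_int (ν₂ : Measure E₂) [SFinite ν₂] (h : E₂ → ℝ≥0∞) (h1 : ∫⁻ y, h y ∂ν₂ = 1)
    (f : A → E₁ × E₂ → ℝ≥0∞) (p : A × E₁) :
    ∫⁻ y, epiCond ν₂ h f p y ∂ν₂ = 1 := by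
  unfold epiCond
  split_ifs with hc
  · exact h1
  · push Not at hc
    simp_rw [div_eq_mul_inv]
    rw [lintegral_mul_const' _ _ (ENNReal.inv_ne_top.2 hc.1)]
    exact ENNReal.mul_inv_cancel hc.1 hc.2

lemma epiMarg_int (ν₁ : Measure E₁) (ν₂ : Measure E₂) [SFinite ν₂] (f : A → E₁ × E₂ → ℝ≥0∞)
    (hf : Measurable (Function.uncurry f)) (s : A) :
    ∫⁻ x, epiMarg ν₂ f s x ∂ν₁ = ∫⁻ p, f s p ∂(ν₁.prod ν₂) := by
  have hfs : Measurable (f s) := hf.comp measurable_prodMk_left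
  rw [lintegral_prod _ hfs.aemeasurable]
  rfl

lemma epiCond_mul (ν₂ : Measure E₂) (h : E₂ → ℝ≥0∞) (f : A → E₁ × E₂ → ℝ≥0∞) (s : A) (x : E₁)
    (h0 : epiMarg ν₂ f s x ≠ 0) (ht : epiMarg ν₂ f s x ≠ ⊤) (y : E₂) :
    epiMarg ν₂ f s x * epiCond ν₂ h f (s, x) y = f s (x, y) := by
  simp only [epiCond, h0, ht, or_self, if_false]
  exact ENNReal.mul_div_cancel h0 ht

lemma epi_marg_good {G₁ : Type} [MeasurableSpace G₁] (γ₁ : Measure G₁) (ν₁ : Measure E₁)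
    (m : E₁ → ℝ≥0∞) (hm : Measurable m) (h1 : ∫⁻ x, m x ∂ν₁ = 1) (T : G₁ → E₁) (hT : Measurable T)
    (hp : γ₁.map T = ν₁.withDensity m) : ∀ᵐ x ∂γ₁, m (T x) ≠ 0 ∧ m (T x) ≠ ⊤ := by
  have h2 : ∀ᵐ z ∂(γ₁.map T), m z ≠ 0 ∧ m z ≠ ⊤ := by
    rw [hp, ae_withDensity_iff hm]
    filter_upwards [ae_lt_top hm (by rw [h1]; simp)] with z hz h0
    exact ⟨h0, hz.ne⟩
  exact ae_of_ae_map hT.aemeasurable h2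

lemma epi_push_prod {G₁ G₂ : Type} [MeasurableSpace G₁] [MeasurableSpace G₂] (γ₁ : Measure G₁)
    (γ₂ : Measure G₂) [SFinite γ₁] [SFinite γ₂] (ν₁ : Measure E₁) (ν₂ : Measure E₂) [SFinite ν₁] [SFinite ν₂]
    (h : E₂ → ℝ≥0∞) (hh : Measurable h)
    (f : A → E₁ × E₂ → ℝ≥0∞) (hf : Measurable (Function.uncurry f)) (s : A)
    (h1 : ∫⁻ p, f s p ∂(ν₁.prod ν₂) = 1)
    (T₁ : G₁ → E₁) (hT₁ : Measurable T₁)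
    (hp₁ : γ₁.map T₁ = ν₁.withDensity (epiMarg ν₂ f s)) (T₂ : A × E₁ → G₂ → E₂)
    (hT₂ : Measurable (Function.uncurry T₂))
    (hp₂ : ∀ p, γ₂.map (T₂ p) = ν₂.withDensity (epiCond ν₂ h f p)) :
    (γ₁.prod γ₂).map (fun x => (T₁ x.1, T₂ (s, T₁ x.1) x.2)) = (ν₁.prod ν₂).withDensity (f s) := by
  have hfs : Measurable (f s) := hf.comp measurable_prodMk_left
  have hmm := epiMarg_meas ν₂ f hf
  have hms : Measurable (epiMarg ν₂ f s) := hmm.comp measurable_prodMk_left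
  have hcm := epiCond_meas ν₂ h hh f hf
  have hm2 : Measurable (fun x : G₁ × G₂ => (T₁ x.1, T₂ (s, T₁ x.1) x.2)) :=
    (hT₁.comp measurable_fst).prodMk (hT₂.comp (by fun_prop :
      Measurable fun x : G₁ × G₂ => ((s, T₁ x.1), x.2)))
  refine Measure.ext_of_lintegral _ fun w hw => ?_
  have hW : Measurable fun q : E₁ × E₂ => epiCond ν₂ h f (s, q.1) q.2 :=
    hcm.comp (by fun_prop : Measurable fun q : E₁ × E₂ => ((s, q.1), q.2))
  have hwm : Measurable (fun x : G₁ × G₂ => w (T₁ x.1, T₂ (s, T₁ x.1) x.2)) := hw.comp hm2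
  rw [lintegral_map hw hm2, lintegral_withDensity_eq_lintegral_mul _ hfs hw,
    lintegral_prod _ hwm.aemeasurable, lintegral_prod _ (hfs.mul hw).aemeasurable]
  have e1 : ∀ z, ∫⁻ y, w (z, T₂ (s, z) y) ∂γ₂ = ∫⁻ y, epiCond ν₂ h f (s, z) y * w (z, y) ∂ν₂ := by
    intro z
    have hwz : Measurable fun y => w (z, y) := hw.comp measurable_prodMk_left
    have hTz : Measurable (T₂ (s, z)) := hT₂.comp measurable_prodMk_left
    have hcz : Measurable (epiCond ν₂ h f (s, z)) := hcm.comp measurable_prodMk_left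
    have := lintegral_map (μ := γ₂) hwz hTz
    rw [← this, hp₂, lintegral_withDensity_eq_lintegral_mul _ hcz hwz]
    rfl
  simp_rw [e1]
  have hM : Measurable fun z => ∫⁻ y, epiCond ν₂ h f (s, z) y * w (z, y) ∂ν₂ :=
    Measurable.lintegral_prod_right' (hW.mul hw)
  have := lintegral_map (μ := γ₁) hM hT₁
  rw [← this, hp₁, lintegral_withDensity_eq_lintegral_mul _ hms hM]
  have hlt := ae_lt_top (μ := ν₁) hms (by rw [epiMarg_int ν₁ ν₂ f hf s, h1]; simp)
  refine lintegral_congr_ae ?_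
  filter_upwards [hlt] with z hz
  by_cases h0 : epiMarg ν₂ f s z = 0
  · have h3 : (fun y => f s (z, y)) =ᵐ[ν₂] 0 :=
      (lintegral_eq_zero_iff (hfs.comp measurable_prodMk_left)).1 h0
    simp only [Pi.mul_apply, h0, zero_mul]
    symm
    have hfw : Measurable fun y => (f s * w) (z, y) :=
      (hfs.mul hw).comp measurable_prodMk_left
    refine (lintegral_eq_zero_iff hfw).2 ?_
    filter_upwards [h3] with y hy
    simp only [Pi.zero_apply] at hy
    simp [hy]
  · simp only [Pi.mul_apply]
    rw [← lintegral_const_mul' _ _ hz.ne]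
    refine lintegral_congr fun y => ?_
    rw [← mul_assoc, epiCond_mul ν₂ h f s z h0 hz.ne]

end prod

lemma epi_fub4 {G₁ G₂ : Type} [MeasurableSpace G₁] [MeasurableSpace G₂] (γ₁ : Measure G₁)
    (γ₂ : Measure G₂) [SFinite γ₁] [SFinite γ₂] (Q : (G₁ × G₂) × (G₁ × G₂) → ℝ≥0∞)
    (hQ : Measurable Q) :
    ∫⁻ x, ∫⁻ y, Q (x, y) ∂(γ₁.prod γ₂) ∂(γ₁.prod γ₂) =
      ∫⁻ x₁, ∫⁻ y₁, ∫⁻ x₂, ∫⁻ y₂, Q ((x₁, x₂), (y₁, y₂)) ∂γ₂ ∂γ₂ ∂γ₁ ∂γ₁ := by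
  have h1 : Measurable fun x => ∫⁻ y, Q (x, y) ∂(γ₁.prod γ₂) :=
    Measurable.lintegral_prod_right' hQ
  rw [lintegral_prod _ h1.aemeasurable]
  refine lintegral_congr fun x₁ => ?_
  have h2 : ∀ x₂, ∫⁻ y, Q ((x₁, x₂), y) ∂(γ₁.prod γ₂) =
      ∫⁻ y₁, ∫⁻ y₂, Q ((x₁, x₂), (y₁, y₂)) ∂γ₂ ∂γ₁ := by
    intro x₂
    have h3 : Measurable fun y => Q ((x₁, x₂), y) := hQ.comp measurable_prodMk_left
    rw [lintegral_prod _ h3.aemeasurable]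
  simp_rw [h2]
  refine lintegral_lintegral_swap ?_
  refine (Measurable.lintegral_prod_right' (ν := γ₂)
    (f := fun q : (G₂ × G₁) × G₂ => Q ((x₁, q.1.1), (q.1.2, q.2))) ?_).aemeasurable
  exact hQ.comp (by fun_prop)

lemma epiTP_prod {a b : ℝ} {E₁ E₂ : Type} [MeasurableSpace E₁] [Add E₁] [MeasurableAdd₂ E₁]
    [MeasurableSpace E₂] [Add E₂] [MeasurableAdd₂ E₂] {ν₁ : Measure E₁} {ν₂ : Measure E₂}
    [SFinite ν₁] [SFinite ν₂] {C₁ C₂ : ℝ≥0∞}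
    (h₁ : EpiTP a b E₁ ν₁ C₁) (h₂ : EpiTP a b E₂ ν₂ C₂) :
    EpiTP a b (E₁ × E₂) (ν₁.prod ν₂) (C₁ * C₂) := by
  obtain ⟨⟨d₁, d₁m, d₁1⟩, G₁, mG₁, γ₁, k₁, hγ₁, hkm₁, hki₁, hk0₁, H₁⟩ := h₁
  obtain ⟨⟨d₂, d₂m, d₂1⟩, G₂, mG₂, γ₂, k₂, hγ₂, hkm₂, hki₂, hk0₂, H₂⟩ := h₂
  have mp1 : MeasurePreserving (Prod.map Prod.fst Prod.fst)
      ((γ₁.prod γ₂).prod (γ₁.prod γ₂)) (γ₁.prod γ₁) :=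
    measurePreserving_fst.prod measurePreserving_fst
  have mp2 : MeasurePreserving (Prod.map Prod.snd Prod.snd)
      ((γ₁.prod γ₂).prod (γ₁.prod γ₂)) (γ₂.prod γ₂) :=
    measurePreserving_snd.prod measurePreserving_snd
  have i1 := mp1.integrable_comp_of_integrable hki₁
  have i2 := mp2.integrable_comp_of_integrable hki₂
  refine ⟨⟨fun p => d₁ p.1 * d₂ p.2, by fun_prop, ?_⟩, G₁ × G₂, inferInstance, γ₁.prod γ₂,
    fun p => (k₁ ∘ Prod.map Prod.fst Prod.fst) p + (k₂ ∘ Prod.map Prod.snd Prod.snd) p,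
    inferInstance, ?_, i1.add i2, ?_, ?_⟩
  · rw [lintegral_prod_mul d₁m.aemeasurable d₂m.aemeasurable, d₁1, d₂1, one_mul]
  · exact (hkm₁.comp mp1.measurable).add (hkm₂.comp mp2.measurable)
  · rw [integral_add i1 i2]
    have e1 := integral_map (μ := (γ₁.prod γ₂).prod (γ₁.prod γ₂)) mp1.measurable.aemeasurable
      (f := k₁) hkm₁.aestronglyMeasurable
    have e2 := integral_map (μ := (γ₁.prod γ₂).prod (γ₁.prod γ₂)) mp2.measurable.aemeasurable
      (f := k₂) hkm₂.aestronglyMeasurable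
    rw [mp1.map_eq, hk0₁] at e1
    rw [mp2.map_eq, hk0₂] at e2
    simp only [Function.comp_apply]
    rw [← e1, ← e2, add_zero]
  intro A B _ _ f g hf hg hf1 hg1
  have hfm := epiMarg_meas ν₂ f hf
  have hgm := epiMarg_meas ν₂ g hg
  have hfm1 : ∀ s, ∫⁻ x, epiMarg ν₂ f s x ∂ν₁ = 1 := fun s => by
    rw [epiMarg_int ν₁ ν₂ f hf, hf1]
  have hgm1 : ∀ s, ∫⁻ x, epiMarg ν₂ g s x ∂ν₁ = 1 := fun s => by
    rw [epiMarg_int ν₁ ν₂ g hg, hg1]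
  obtain ⟨T₁, U₁, hT₁, hU₁, hTp₁, hUp₁, hTU₁⟩ := H₁ A B _ _ hfm hgm hfm1 hgm1
  obtain ⟨T₂, U₂, hT₂, hU₂, hTp₂, hUp₂, hTU₂⟩ := H₂ (A × E₁) (B × E₁) _ _
    (epiCond_meas ν₂ d₂ d₂m f hf) (epiCond_meas ν₂ d₂ d₂m g hg)
    (epiCond_int ν₂ d₂ d₂1 f) (epiCond_int ν₂ d₂ d₂1 g)
  have hT₁s : ∀ s, Measurable (T₁ s) := fun s => hT₁.comp measurable_prodMk_left
  have hU₁s : ∀ s, Measurable (U₁ s) := fun s => hU₁.comp measurable_prodMk_left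
  have hTm : Measurable (Function.uncurry fun s (x : G₁ × G₂) =>
      (T₁ s x.1, T₂ (s, T₁ s x.1) x.2)) := by
    have q1 : Measurable fun p : A × (G₁ × G₂) => T₁ p.1 p.2.1 :=
      hT₁.comp (by fun_prop : Measurable fun p : A × (G₁ × G₂) => (p.1, p.2.1))
    exact q1.prodMk (hT₂.comp ((measurable_fst.prodMk q1).prodMk (by fun_prop)))
  have hUm : Measurable (Function.uncurry fun s (x : G₁ × G₂) =>
      (U₁ s x.1, U₂ (s, U₁ s x.1) x.2)) := by
    have q1 : Measurable fun p : B × (G₁ × G₂) => U₁ p.1 p.2.1 :=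
      hU₁.comp (by fun_prop : Measurable fun p : B × (G₁ × G₂) => (p.1, p.2.1))
    exact q1.prodMk (hU₂.comp ((measurable_fst.prodMk q1).prodMk (by fun_prop)))
  refine ⟨fun s x => (T₁ s x.1, T₂ (s, T₁ s x.1) x.2), fun s x => (U₁ s x.1, U₂ (s, U₁ s x.1) x.2),
    hTm, hUm,
    fun s => epi_push_prod γ₁ γ₂ ν₁ ν₂ d₂ d₂m f hf s (hf1 s) (T₁ s) (hT₁s s) (hTp₁ s) T₂ hT₂ hTp₂,
    fun s => epi_push_prod γ₁ γ₂ ν₁ ν₂ d₂ d₂m g hg s (hg1 s) (U₁ s) (hU₁s s) (hUp₁ s) U₂ hU₂ hUp₂,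
    fun s t r hr => ?_⟩
  have hTsm : Measurable (fun x : G₁ × G₂ => (T₁ s x.1, T₂ (s, T₁ s x.1) x.2)) :=
    hTm.comp measurable_prodMk_left
  have hUtm : Measurable (fun x : G₁ × G₂ => (U₁ t x.1, U₂ (t, U₁ t x.1) x.2)) :=
    hUm.comp measurable_prodMk_left
  have hfs : Measurable (f s) := hf.comp measurable_prodMk_left
  have hgt : Measurable (g t) := hg.comp measurable_prodMk_left
  have g1 := epi_marg_good γ₁ ν₁ (epiMarg ν₂ f s) (hfm.comp measurable_prodMk_left) (hfm1 s) (T₁ s)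
    (hT₁s s) (hTp₁ s)
  have g2 := epi_marg_good γ₁ ν₁ (epiMarg ν₂ g t) (hgm.comp measurable_prodMk_left) (hgm1 t) (U₁ t)
    (hU₁s t) (hUp₁ t)
  have hRm : Measurable fun z => ∫⁻ w, r (z, w) ∂ν₂ := Measurable.lintegral_prod_right' hr
  have hQ : Measurable fun p : (G₁ × G₂) × (G₁ × G₂) =>
      r ((T₁ s p.1.1, T₂ (s, T₁ s p.1.1) p.1.2) + (U₁ t p.2.1, U₂ (t, U₁ t p.2.1) p.2.2)) *
      f s (T₁ s p.1.1, T₂ (s, T₁ s p.1.1) p.1.2) ^ (-a ^ 2) *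
      g t (U₁ t p.2.1, U₂ (t, U₁ t p.2.1) p.2.2) ^ (-b ^ 2) *
      ENNReal.ofReal (Real.exp ((k₁ ∘ Prod.map Prod.fst Prod.fst) p +
        (k₂ ∘ Prod.map Prod.snd Prod.snd) p)) := by
    have m1 : Measurable fun p : (G₁ × G₂) × (G₁ × G₂) =>
        (T₁ s p.1.1, T₂ (s, T₁ s p.1.1) p.1.2) := hTsm.comp measurable_fst
    have m2 : Measurable fun p : (G₁ × G₂) × (G₁ × G₂) =>
        (U₁ t p.2.1, U₂ (t, U₁ t p.2.1) p.2.2) := hUtm.comp measurable_snd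
    have m3 := hkm₁.comp mp1.measurable
    have m4 := hkm₂.comp mp2.measurable
    refine (((hr.comp ?_).mul ((hfs.comp m1).pow_const _)).mul ((hgt.comp m2).pow_const _)).mul
      (Real.measurable_exp.comp (m3.add m4)).ennreal_ofReal
    exact ((measurable_fst.comp m1).add (measurable_fst.comp m2)).prodMk
      ((measurable_snd.comp m1).add (measurable_snd.comp m2))
  refine le_trans (le_of_eq (epi_fub4 γ₁ γ₂ _ hQ)) ?_
  calc _ ≤ ∫⁻ x₁, ∫⁻ y₁, (C₂ * ∫⁻ w, r (T₁ s x₁ + U₁ t y₁, w) ∂ν₂) *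
            epiMarg ν₂ f s (T₁ s x₁) ^ (-a ^ 2) * epiMarg ν₂ g t (U₁ t y₁) ^ (-b ^ 2) *
            ENNReal.ofReal (Real.exp (k₁ (x₁, y₁))) ∂γ₁ ∂γ₁ := by
        refine lintegral_mono_ae ?_
        filter_upwards [g1] with x₁ hx
        refine lintegral_mono_ae ?_
        filter_upwards [g2] with y₁ hy
        set K := epiMarg ν₂ f s (T₁ s x₁) ^ (-a ^ 2) * epiMarg ν₂ g t (U₁ t y₁) ^ (-b ^ 2) *
            ENNReal.ofReal (Real.exp (k₁ (x₁, y₁))) with hK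
        have hKt : K ≠ ⊤ := ENNReal.mul_ne_top (ENNReal.mul_ne_top
          (ENNReal.rpow_ne_top_of_ne_zero hx.1 hx.2) (ENNReal.rpow_ne_top_of_ne_zero hy.1 hy.2))
          ENNReal.ofReal_ne_top
        have key := hTU₂ (s, T₁ s x₁) (t, U₁ t y₁) (fun w => r (T₁ s x₁ + U₁ t y₁, w))
          (hr.comp measurable_prodMk_left)
        have key2 := mul_le_mul_right key K
        refine le_trans (le_of_eq ?_) (key2.trans (le_of_eq ?_))
        · rw [← lintegral_const_mul' _ _ hKt]
          refine lintegral_congr fun x₂ => ?_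
          rw [← lintegral_const_mul' _ _ hKt]
          refine lintegral_congr fun y₂ => ?_
          rw [← epiCond_mul ν₂ d₂ f s _ hx.1 hx.2, ← epiCond_mul ν₂ d₂ g t _ hy.1 hy.2,
            ENNReal.mul_rpow_eq_ite, ENNReal.mul_rpow_eq_ite]
          simp only [hx.1, hx.2, hy.1, hy.2, false_and, or_self, if_false, Function.comp_apply,
            Prod.map_apply, Prod.mk_add_mk]
          rw [Real.exp_add, ENNReal.ofReal_mul (Real.exp_pos _).le, hK]
          ring
        · rw [hK]; ring
    _ ≤ C₁ * ∫⁻ z, C₂ * ∫⁻ w, r (z, w) ∂ν₂ ∂ν₁ :=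
        hTU₁ s t (fun z => C₂ * ∫⁻ w, r (z, w) ∂ν₂) (hRm.const_mul _)
    _ = C₁ * C₂ * ∫⁻ z, r z ∂(ν₁.prod ν₂) := by
        rw [lintegral_const_mul _ hRm, lintegral_prod _ hr.aemeasurable, mul_assoc]

lemma epiTP_pi (a b : ℝ) (ha : 0 < a) (hb : 0 < b) (hab : a ^ 2 + b ^ 2 = 1) (n : ℕ) :
    EpiTP a b (Fin n → ℝ) volume (ENNReal.ofReal (a ^ (a ^ 2) * b ^ (b ^ 2)) ^ n) := by
  induction n with
  | zero => simpa using epiTP_zero a b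
  | succ n ih =>
    have h := epiTP_prod (epiTP_real a b ha hb hab) ih
    rw [pow_succ']
    refine epiTP_transfer h (MeasurableEquiv.piFinSuccAbove (fun _ => ℝ) 0).symm
      (volume_preserving_piFinSuccAbove (fun _ : Fin (n + 1) => ℝ) 0).symm ?_
    intro x y
    rw [MeasurableEquiv.symm_apply_eq]
    ext i
    · simp [MeasurableEquiv.piFinSuccAbove]
    · rfl

lemma epiTP_euclidean (a b : ℝ) (ha : 0 < a) (hb : 0 < b) (hab : a ^ 2 + b ^ 2 = 1) (n : ℕ) :
    EpiTP a b (EuclideanSpace ℝ (Fin n)) volume (ENNReal.ofReal (a ^ (a ^ 2) * b ^ (b ^ 2)) ^ n) :=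
  epiTP_transfer (epiTP_pi a b ha hb hab n) (MeasurableEquiv.toLp 2 (Fin n → ℝ))
    (PiLp.volume_preserving_toLp (Fin n)) (fun _ _ => rfl)

lemma epi_ent {E : Type} [MeasurableSpace E] (ν μ : Measure E) [SigmaFinite ν]
    [IsProbabilityMeasure μ] (hac : μ ≪ ν) (hfin : HasFiniteEntropy ν μ)
    {Ω : Type} [MeasurableSpace Ω] (P : Measure Ω) (φ : Ω → E) (hφ : MeasurePreserving φ P μ) :
    Integrable (fun w => Real.log (μ.rnDeriv ν (φ w)).toReal) P ∧
      ∫ w, Real.log (μ.rnDeriv ν (φ w)).toReal ∂P = -diffEntropy ν μ ∧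
      ∀ᵐ w ∂P, μ.rnDeriv ν (φ w) ≠ 0 ∧ μ.rnDeriv ν (φ w) ≠ ⊤ := by
  have hm : Measurable (fun x => Real.log (μ.rnDeriv ν x).toReal) :=
    Real.measurable_log.comp (Measure.measurable_rnDeriv μ ν).ennreal_toReal
  have h1 : Integrable (fun x => Real.log (μ.rnDeriv ν x).toReal) μ :=
    (integrable_rnDeriv_smul_iff hac).1 hfin
  refine ⟨hφ.integrable_comp_of_integrable h1, ?_, ?_⟩
  · have h2 := integral_map (μ := P) hφ.measurable.aemeasurable
      (f := fun x => Real.log (μ.rnDeriv ν x).toReal) hm.aestronglyMeasurable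
    rw [← h2, hφ.map_eq, ← integral_rnDeriv_smul hac]
    simp [diffEntropy]
  · have h3 : ∀ᵐ x ∂(P.map φ), μ.rnDeriv ν x ≠ 0 ∧ μ.rnDeriv ν x ≠ ⊤ := by
      rw [hφ.map_eq]
      filter_upwards [Measure.rnDeriv_pos hac, hac.ae_le (Measure.rnDeriv_lt_top μ ν)] with x h4 h5
      exact ⟨h4.ne', h5.ne⟩
    exact ae_of_ae_map hφ.measurable.aemeasurable h3

lemma epi_core (a b : ℝ) (ha : 0 < a) (hb : 0 < b) (hab : a ^ 2 + b ^ 2 = 1) (n : ℕ)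
    (μ₁ μ₂ μ₃ : Measure (EuclideanSpace ℝ (Fin n))) [IsProbabilityMeasure μ₁]
    [IsProbabilityMeasure μ₂] [IsProbabilityMeasure μ₃] (hac₁ : μ₁ ≪ volume) (hac₂ : μ₂ ≪ volume)
    (hac₃ : μ₃ ≪ volume) (hf₁ : HasFiniteEntropy volume μ₁) (hf₂ : HasFiniteEntropy volume μ₂)
    (hf₃ : HasFiniteEntropy volume μ₃)
    (hsum : MeasurePreserving (fun p => p.1 + p.2) (μ₁.prod μ₂) μ₃) :
    a ^ 2 * diffEntropy volume μ₁ + b ^ 2 * diffEntropy volume μ₂ - diffEntropy volume μ₃ ≤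
      n * (a ^ 2 * Real.log a + b ^ 2 * Real.log b) := by
  obtain ⟨-, G, mG, γ, k, hγ, hkm, hki, hk0, H⟩ := epiTP_euclidean a b ha hb hab n
  have hm₁ := Measure.measurable_rnDeriv μ₁ volume
  have hm₂ := Measure.measurable_rnDeriv μ₂ volume
  have hm₃ := Measure.measurable_rnDeriv μ₃ volume
  obtain ⟨T', U', hT', hU', hTp, hUp, hTU⟩ := H Unit Unit (fun _ => μ₁.rnDeriv volume)
    (fun _ => μ₂.rnDeriv volume) (hm₁.comp measurable_snd) (hm₂.comp measurable_snd)
    (fun _ => by rw [Measure.lintegral_rnDeriv hac₁, measure_univ])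
    (fun _ => by rw [Measure.lintegral_rnDeriv hac₂, measure_univ])
  have hT : Measurable (T' ()) := hT'.comp measurable_prodMk_left
  have hU : Measurable (U' ()) := hU'.comp measurable_prodMk_left
  have hTp := hTp ()
  have hUp := hUp ()
  have hTU := hTU () () (μ₃.rnDeriv volume) hm₃
  generalize T' () = T at *
  generalize U' () = U at *
  rw [Measure.withDensity_rnDeriv_eq _ _ hac₁] at hTp
  rw [Measure.withDensity_rnDeriv_eq _ _ hac₂] at hUp
  rw [Measure.lintegral_rnDeriv hac₃, measure_univ, mul_one] at hTU
  have pT : MeasurePreserving T γ μ₁ := ⟨hT, hTp⟩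
  have pU : MeasurePreserving U γ μ₂ := ⟨hU, hUp⟩
  have q1 : MeasurePreserving (fun p : G × G => T p.1) (γ.prod γ) μ₁ :=
    pT.comp measurePreserving_fst
  have q2 : MeasurePreserving (fun p : G × G => U p.2) (γ.prod γ) μ₂ :=
    pU.comp measurePreserving_snd
  have q3 : MeasurePreserving (fun p : G × G => T p.1 + U p.2) (γ.prod γ) μ₃ :=
    hsum.comp (pT.prod pU)
  obtain ⟨i1, e1, g1⟩ := epi_ent volume μ₁ hac₁ hf₁ _ _ q1
  obtain ⟨i2, e2, g2⟩ := epi_ent volume μ₂ hac₂ hf₂ _ _ q2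
  obtain ⟨i3, e3, g3⟩ := epi_ent volume μ₃ hac₃ hf₃ _ _ q3
  set c : ℝ := n * (a ^ 2 * Real.log a + b ^ 2 * Real.log b) with hc
  set L₁ : G × G → ℝ := fun p => Real.log (μ₁.rnDeriv volume (T p.1)).toReal with hL₁
  set L₂ : G × G → ℝ := fun p => Real.log (μ₂.rnDeriv volume (U p.2)).toReal with hL₂
  set L₃ : G × G → ℝ := fun p => Real.log (μ₃.rnDeriv volume (T p.1 + U p.2)).toReal with hL₃
  set D : G × G → ℝ := fun p => L₃ p - a ^ 2 * L₁ p - b ^ 2 * L₂ p + k p - c with hD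
  have iD : Integrable D (γ.prod γ) :=
    (((i3.sub (i1.const_mul _)).sub (i2.const_mul _)).add hki).sub (integrable_const _)
  have eD : ∫ p, D p ∂(γ.prod γ) = -diffEntropy volume μ₃ + a ^ 2 * diffEntropy volume μ₁
      + b ^ 2 * diffEntropy volume μ₂ - c := by
    have s1 := integral_sub (((i3.sub (i1.const_mul (a ^ 2))).sub (i2.const_mul (b ^ 2))).add hki)
      (integrable_const c)
    have s2 := integral_add ((i3.sub (i1.const_mul (a ^ 2))).sub (i2.const_mul (b ^ 2))) hki
    have s3 := integral_sub (i3.sub (i1.const_mul (a ^ 2))) (i2.const_mul (b ^ 2))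
    have s4 := integral_sub i3 (i1.const_mul (a ^ 2))
    simp only [Pi.sub_apply, Pi.add_apply] at s1 s2 s3 s4
    simp only [hD]
    rw [s1, s2, s3, s4, integral_const_mul, integral_const_mul, e1, e2, e3, hk0, integral_const]
    simp
  have hCc : ENNReal.ofReal (a ^ (a ^ 2) * b ^ (b ^ 2)) ^ n = ENNReal.ofReal (Real.exp c) := by
    rw [← ENNReal.ofReal_pow (by positivity), hc, Real.exp_nat_mul, Real.exp_add,
      Real.rpow_def_of_pos ha, Real.rpow_def_of_pos hb, mul_comm (Real.log a), mul_comm (Real.log b)]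
  have hmk : Measurable fun p : G × G => μ₃.rnDeriv volume (T p.1 + U p.2) *
      μ₁.rnDeriv volume (T p.1) ^ (-a ^ 2) * μ₂.rnDeriv volume (U p.2) ^ (-b ^ 2) *
      ENNReal.ofReal (Real.exp (k (p.1, p.2))) :=
    (((hm₃.comp q3.measurable).mul ((hm₁.comp q1.measurable).pow_const _)).mul
      ((hm₂.comp q2.measurable).pow_const _)).mul (Real.measurable_exp.comp hkm).ennreal_ofReal
  have hexp : ∫⁻ p, ENNReal.ofReal (Real.exp (D p + c)) ∂(γ.prod γ) ≤ ENNReal.ofReal (Real.exp c) := by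
    rw [← hCc]
    refine le_trans (le_of_eq ?_) hTU
    rw [← lintegral_prod _ hmk.aemeasurable]
    refine lintegral_congr_ae ?_
    filter_upwards [g1, g2, g3] with p h1 h2 h3
    have aux : ∀ (x : ℝ≥0∞) (t : ℝ), x ≠ 0 → x ≠ ⊤ →
        x ^ t = ENNReal.ofReal (Real.exp (t * Real.log x.toReal)) := by
      intro x t h0 ht
      have hpos := ENNReal.toReal_pos h0 ht
      conv_lhs => rw [← ENNReal.ofReal_toReal ht]
      rw [ENNReal.ofReal_rpow_of_pos hpos, Real.rpow_def_of_pos hpos, mul_comm]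
    have a3 := aux _ 1 h3.1 h3.2
    rw [ENNReal.rpow_one] at a3
    rw [aux _ _ h1.1 h1.2, aux _ _ h2.1 h2.2, a3, ← ENNReal.ofReal_mul (Real.exp_pos _).le,
      ← ENNReal.ofReal_mul (by positivity), ← ENNReal.ofReal_mul (by positivity),
      ← Real.exp_add, ← Real.exp_add, ← Real.exp_add]
    congr 2
    simp only [hD, hL₁, hL₂, hL₃]
    ring
  have hexp2 : ∫⁻ p, ENNReal.ofReal (Real.exp (D p)) ∂(γ.prod γ) ≤ 1 := by
    have : ∀ p, ENNReal.ofReal (Real.exp (D p)) =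
        ENNReal.ofReal (Real.exp (D p + c)) * ENNReal.ofReal (Real.exp (-c)) := by
      intro p
      rw [← ENNReal.ofReal_mul (Real.exp_pos _).le, ← Real.exp_add]
      congr 2
      ring
    simp_rw [this]
    rw [lintegral_mul_const' _ _ ENNReal.ofReal_ne_top]
    refine (mul_le_mul_left hexp _).trans (le_of_eq ?_)
    rw [← ENNReal.ofReal_mul (Real.exp_pos _).le, ← Real.exp_add]
    simp
  have iE : Integrable (fun p => Real.exp (D p)) (γ.prod γ) := by
    refine ⟨Real.continuous_exp.comp_aestronglyMeasurable iD.1, ?_⟩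
    rw [hasFiniteIntegral_iff_ofReal (ae_of_all _ fun p => (Real.exp_pos _).le)]
    exact hexp2.trans_lt ENNReal.one_lt_top
  have hE1 : ∫ p, Real.exp (D p) ∂(γ.prod γ) ≤ 1 := by
    rw [integral_eq_lintegral_of_nonneg_ae (ae_of_all _ fun p => (Real.exp_pos _).le) iE.1]
    exact ENNReal.toReal_mono ENNReal.one_ne_top hexp2
  have hfinal : ∫ p, (D p + 1) ∂(γ.prod γ) ≤ ∫ p, Real.exp (D p) ∂(γ.prod γ) :=
    integral_mono (iD.add (integrable_const _)) iE (fun p => Real.add_one_le_exp _)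
  rw [integral_add iD (integrable_const _), eD] at hfinal
  simp at hfinal
  linarith

end helpers

/-- The classical Entropy Power Inequality. -/
theorem entropy_power_inequality
    {Ω : Type*} [MeasureSpace Ω] [IsProbabilityMeasure (ℙ : Measure Ω)] {n : ℕ} (hn : 0 < n)
    (X Y : Ω → EuclideanSpace ℝ (Fin n)) (hX : Measurable X) (hY : Measurable Y)
    (hindep : IndepFun X Y ℙ)
    (hXac : Measure.map X ℙ ≪ volume) (hYac : Measure.map Y ℙ ≪ volume)
    (hX2 : Integrable (fun ω => ‖X ω‖ ^ 2) ℙ) (hY2 : Integrable (fun ω => ‖Y ω‖ ^ 2) ℙ)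
    (hXent : HasFiniteEntropy volume (Measure.map X ℙ))
    (hYent : HasFiniteEntropy volume (Measure.map Y ℙ))
    (hSent : HasFiniteEntropy volume (Measure.map (fun ω => X ω + Y ω) ℙ)) :
    Real.exp (2 * diffEntropy volume (Measure.map (fun ω => X ω + Y ω) ℙ) / n)
      ≥ Real.exp (2 * diffEntropy volume (Measure.map X ℙ) / n)
        + Real.exp (2 * diffEntropy volume (Measure.map Y ℙ) / n) := by
  have p1 : IsProbabilityMeasure (Measure.map X ℙ) := Measure.isProbabilityMeasure_map hX.aemeasurable
  have p2 : IsProbabilityMeasure (Measure.map Y ℙ) := Measure.isProbabilityMeasure_map hY.aemeasurable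
  have p3 : IsProbabilityMeasure (Measure.map (fun ω => X ω + Y ω) ℙ) :=
    Measure.isProbabilityMeasure_map (hX.add hY).aemeasurable
  have hprod := (indepFun_iff_map_prod_eq_prod_map_map hX.aemeasurable hY.aemeasurable).1 hindep
  have hsum : MeasurePreserving (fun p => p.1 + p.2) ((Measure.map X ℙ).prod (Measure.map Y ℙ))
      (Measure.map (fun ω => X ω + Y ω) ℙ) := by
    have hadd : Measurable fun p : EuclideanSpace ℝ (Fin n) × EuclideanSpace ℝ (Fin n) =>
        p.1 + p.2 := measurable_fst.add measurable_snd
    refine ⟨hadd, ?_⟩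
    rw [← hprod, Measure.map_map hadd (hX.prodMk hY)]
    rfl
  have hac : Measure.map (fun ω => X ω + Y ω) ℙ ≪ volume := by
    rw [← hsum.map_eq]
    exact Measure.conv_absolutelyContinuous hYac
  set h₁ := diffEntropy volume (Measure.map X ℙ)
  set h₂ := diffEntropy volume (Measure.map Y ℙ)
  set h₃ := diffEntropy volume (Measure.map (fun ω => X ω + Y ω) ℙ)
  have hn' : (0 : ℝ) < n := by exact_mod_cast hn
  set N₁ := Real.exp (2 * h₁ / n) with hN₁
  set N₂ := Real.exp (2 * h₂ / n) with hN₂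
  have N₁p : 0 < N₁ := Real.exp_pos _
  have N₂p : 0 < N₂ := Real.exp_pos _
  have hl : 0 < N₁ / (N₁ + N₂) := by positivity
  have hm : 0 < N₂ / (N₁ + N₂) := by positivity
  have sa : Real.sqrt (N₁ / (N₁ + N₂)) ^ 2 = N₁ / (N₁ + N₂) := Real.sq_sqrt hl.le
  have sb : Real.sqrt (N₂ / (N₁ + N₂)) ^ 2 = N₂ / (N₁ + N₂) := Real.sq_sqrt hm.le
  have hone : N₁ / (N₁ + N₂) + N₂ / (N₁ + N₂) = 1 := by field_simp
  have core := epi_core (Real.sqrt (N₁ / (N₁ + N₂))) (Real.sqrt (N₂ / (N₁ + N₂)))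
    (Real.sqrt_pos.2 hl) (Real.sqrt_pos.2 hm) (by rw [sa, sb, hone]) n _ _ _ hXac hYac hac
    hXent hYent hSent hsum
  rw [sa, sb, Real.log_sqrt hl.le, Real.log_sqrt hm.le,
    Real.log_div N₁p.ne' (by positivity), Real.log_div N₂p.ne' (by positivity), hN₁, hN₂,
    Real.log_exp, Real.log_exp, ← hN₁, ← hN₂] at core
  rw [ge_iff_le, ← Real.exp_log (by positivity : 0 < N₁ + N₂), Real.exp_le_exp, le_div_iff₀ hn']
  set l := N₁ / (N₁ + N₂)
  set m := N₂ / (N₁ + N₂)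
  set L := Real.log (N₁ + N₂)
  change l * h₁ + m * h₂ - h₃ ≤ _ at core
  have e : (n : ℝ) * (l * ((2 * h₁ / n - L) / 2) + m * ((2 * h₂ / n - L) / 2)) =
      l * h₁ + m * h₂ - (l + m) * L * n / 2 := by
    field_simp
    ring
  rw [e, hone] at core
  linarith

end
end

section
/- Entropy Power Inequality with classical conditioning: Let M be a random variable with values in a countable set 𝓜 with probabilities q(m), and let X and Y be random variables with values in ℝⁿ such that, conditioned on M = m, X and Y are independent with probability densities and finite differential entropies S(X|M=m), S(Y|M=m), S(X+Y|M=m), and such that the conditional entropies S(X|M), S(Y|M), S(X+Y|M) are finite. Then exp(2S(X+Y|M)/n) ≥ exp(2S(X|M)/n) + exp(2S(Y|M)/n). -/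
open MeasureTheory ProbabilityTheory Real Filter

noncomputable section

/-- The conditional differential entropy `S(X|M) = Σ_m q(m) S(X|M=m)` of a random variable `X`
with values in `ℝⁿ` given a random variable `M` with values in a countable set `𝓜`. -/
def condDiffEntropy {Ω : Type*} [MeasureSpace Ω] {𝓜 : Type*} [MeasurableSpace 𝓜] {n : ℕ}
    (X : Ω → EuclideanSpace ℝ (Fin n)) (M : Ω → 𝓜) : ℝ :=
  ∑' m : 𝓜, (ℙ (M ⁻¹' {m})).toReal * diffEntropy volume (Measure.map X (ℙ[|M ⁻¹' {m}]))

namespace EPI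
open scoped ENNReal Topology

/-- The one-dimensional Gaussian density `exp (-π x²)`. -/
def rho1 (x : ℝ) : ℝ≥0∞ := ENNReal.ofReal (Real.exp (-π * x ^ 2))

/-- Lower right derivative along `1/(n+1)`. -/
def lowD (T : ℝ → ℝ) (x : ℝ) : ℝ≥0∞ :=
  liminf (fun n : ℕ => ENNReal.ofReal (((n : ℝ) + 1) * (T (x + 1 / ((n : ℝ) + 1)) - T x))) atTop

lemma lowD_eq {T : ℝ → ℝ} {t x : ℝ} (h : HasDerivAt T t x) : lowD T x = ENNReal.ofReal t := by
  apply Tendsto.liminf_eq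
  apply (ENNReal.continuous_ofReal.tendsto t).comp
  have h1 := hasDerivAt_iff_tendsto_slope_zero.1 h
  have h2 : Tendsto (fun n : ℕ => (1 : ℝ) / ((n : ℝ) + 1)) atTop (𝓝[≠] 0) := by
    apply tendsto_nhdsWithin_of_tendsto_nhds_of_eventually_within
    · exact tendsto_one_div_add_atTop_nhds_zero_nat
    · refine Eventually.of_forall fun n => ?_
      have : (0 : ℝ) < (n : ℝ) + 1 := by positivity
      simp only [Set.mem_compl_iff, Set.mem_singleton_iff]
      positivity
  refine (h1.comp h2).congr fun n => ?_
  simp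

lemma measurable_rho1 : Measurable rho1 := by
  unfold rho1; fun_prop

lemma rho1_pos (x : ℝ) : rho1 x ≠ 0 := by
  simp [rho1, Real.exp_pos]

lemma lintegral_rho1 : ∫⁻ x, rho1 x = 1 := by
  unfold rho1
  rw [← ofReal_integral_eq_lintegral_ofReal (integrable_exp_neg_mul_sq Real.pi_pos)
    (Eventually.of_forall fun x => (Real.exp_pos _).le), integral_gaussian]
  simp [Real.pi_ne_zero]

/-- the one dimensional Gaussian measure -/
def gam1 : Measure ℝ := volume.withDensity rho1

instance : IsProbabilityMeasure gam1 :=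
  ⟨by rw [gam1, withDensity_apply _ MeasurableSet.univ]; simpa using lintegral_rho1⟩

lemma cdf_continuous (μ : Measure ℝ) [IsProbabilityMeasure μ] (h : μ ≪ volume) :
    Continuous (cdf μ) := by
  rw [continuous_iff_continuousAt]
  intro x
  have h1 : (cdf μ).measure {x} = 0 := by
    rw [measure_cdf]; exact h (by simp)
  rw [(monotone_cdf μ).continuousAt_iff_leftLim_eq_rightLim, StieltjesFunction.rightLim_eq]
  rw [StieltjesFunction.measure_singleton, ENNReal.ofReal_eq_zero] at h1
  exact le_antisymm ((monotone_cdf μ).leftLim_le le_rfl) (by linarith)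

lemma gam1_ac : gam1 ≪ volume := withDensity_absolutelyContinuous _ _

lemma ac_gam1 : volume ≪ gam1 :=
  withDensity_absolutelyContinuous' measurable_rho1.aemeasurable
    (Eventually.of_forall rho1_pos)

lemma cdf_gam1_strictMono : StrictMono (cdf gam1) := by
  intro x y hxy
  have h1 : (0 : ℝ≥0∞) < gam1 (Set.Ioc x y) := by
    rw [pos_iff_ne_zero]
    intro h
    have := ac_gam1 h
    simp at this
    linarith
  rw [← measure_cdf gam1, StieltjesFunction.measure_Ioc, ENNReal.ofReal_pos] at h1
  linarith

lemma cdf_gam1_pos (x : ℝ) : 0 < cdf gam1 x :=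
  lt_of_le_of_lt (cdf_nonneg _ (x - 1)) (cdf_gam1_strictMono (by linarith))

lemma cdf_gam1_lt_one (x : ℝ) : cdf gam1 x < 1 :=
  lt_of_lt_of_le (cdf_gam1_strictMono (by linarith : x < x + 1)) (cdf_le_one _ (x + 1))

/-- monotone transport map from the Gaussian to `μ` -/
def qt (μ : Measure ℝ) (x : ℝ) : ℝ := sInf {y | cdf gam1 x ≤ cdf μ y}

section qt
variable (μ : Measure ℝ) [IsProbabilityMeasure μ]
set_option linter.unusedSectionVars false

lemma qt_nonempty (x : ℝ) : {y | cdf gam1 x ≤ cdf μ y}.Nonempty := by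
  have := (tendsto_cdf_atTop μ).eventually (lt_mem_nhds (cdf_gam1_lt_one x))
  obtain ⟨y, hy⟩ := this.exists
  exact ⟨y, hy.le⟩

lemma qt_bdd (x : ℝ) : BddBelow {y | cdf gam1 x ≤ cdf μ y} := by
  have := (tendsto_cdf_atBot μ).eventually (gt_mem_nhds (cdf_gam1_pos x))
  obtain ⟨y, hy⟩ := this.exists
  refine ⟨y, fun z hz => ?_⟩
  by_contra! hlt
  have := monotone_cdf μ hlt.le
  simp only [Set.mem_ofPred_eq] at hz
  linarith

lemma qt_le_iff (h : μ ≪ volume) (x y : ℝ) : qt μ x ≤ y ↔ cdf gam1 x ≤ cdf μ y := by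
  constructor
  · intro hxy
    have hc : IsClosed {y | cdf gam1 x ≤ cdf μ y} :=
      isClosed_le continuous_const (cdf_continuous μ h)
    have := hc.csInf_mem (qt_nonempty μ x) (qt_bdd μ x)
    exact le_trans this (monotone_cdf μ hxy)
  · intro hxy
    exact csInf_le (qt_bdd μ x) hxy

lemma cdf_qt (h : μ ≪ volume) (x : ℝ) : cdf μ (qt μ x) = cdf gam1 x := by
  apply le_antisymm
  · have h1 : Tendsto (cdf μ) (𝓝[<] (qt μ x)) (𝓝 (cdf μ (qt μ x))) :=
      ((cdf_continuous μ h).tendsto _).mono_left nhdsWithin_le_nhds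
    refine le_of_tendsto h1 ?_
    filter_upwards [self_mem_nhdsWithin] with y hy
    by_contra! hlt
    have := (qt_le_iff μ h x y).2 hlt.le
    exact absurd hy (not_lt.2 this)
  · exact (qt_le_iff μ h x _).1 le_rfl

lemma qt_mono : Monotone (qt μ) := by
  intro x y hxy
  apply csInf_le_csInf (qt_bdd μ x) (qt_nonempty μ y)
  intro z hz
  exact le_trans (monotone_cdf gam1 hxy) hz

lemma map_qt (h : μ ≪ volume) : Measure.map (qt μ) gam1 = μ := by
  have hm : Measurable (qt μ) := (qt_mono μ).measurable
  have : IsProbabilityMeasure (Measure.map (qt μ) gam1) :=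
    Measure.isProbabilityMeasure_map hm.aemeasurable
  apply Measure.ext_of_Iic
  intro y
  rw [Measure.map_apply hm measurableSet_Iic]
  have h1 : qt μ ⁻¹' Set.Iic y = {x | cdf gam1 x ≤ cdf μ y} := by
    ext x; simp [qt_le_iff μ h]
  rw [h1, ← ofReal_cdf μ y]
  rcases (cdf_nonneg μ y).eq_or_lt with h0 | h0
  · rw [← h0]
    have : {x | cdf gam1 x ≤ 0} = ∅ := by
      ext x; simp [cdf_gam1_pos x]
    simp [this]
  rcases (cdf_le_one μ y).eq_or_lt with h2 | h2
  · rw [h2]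
    have : {x | cdf gam1 x ≤ 1} = Set.univ := by
      ext x; simp [cdf_le_one]
    simp [this]
  · obtain ⟨x0, hx0⟩ : ∃ x0, cdf gam1 x0 = cdf μ y := by
      apply mem_range_of_exists_le_of_exists_ge (cdf_continuous gam1 gam1_ac)
      · obtain ⟨z, hz⟩ := ((tendsto_cdf_atBot gam1).eventually (gt_mem_nhds h0)).exists
        exact ⟨z, hz.le⟩
      · obtain ⟨z, hz⟩ := ((tendsto_cdf_atTop gam1).eventually (lt_mem_nhds h2)).exists
        exact ⟨z, hz.le⟩
    have : {x | cdf gam1 x ≤ cdf μ y} = Set.Iic x0 := by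
      ext x; simp [← hx0, cdf_gam1_strictMono.le_iff_le]
    rw [this, ← hx0, ofReal_cdf]

end qt

lemma ae_hasDerivAt_cdf (f : ℝ → ℝ≥0∞) (hf : Measurable f)
    [IsProbabilityMeasure (volume.withDensity f)] :
    ∀ᵐ x, HasDerivAt (cdf (volume.withDensity f)) (f x).toReal x := by
  filter_upwards [StieltjesFunction.ae_hasDerivAt (cdf (volume.withDensity f)),
    Measure.rnDeriv_withDensity volume hf] with x h1 h2
  rwa [measure_cdf, h2] at h1

lemma qt_deriv (f : ℝ → ℝ≥0∞) (hf : Measurable f) (hf1 : ∫⁻ x, f x = 1) :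
    ∀ᵐ x, lowD (qt (volume.withDensity f)) x * f (qt (volume.withDensity f) x) = rho1 x := by
  have : IsProbabilityMeasure (volume.withDensity f) :=
    ⟨by rw [withDensity_apply _ MeasurableSet.univ]; simpa using hf1⟩
  have : IsProbabilityMeasure (volume.withDensity rho1) :=
    inferInstanceAs (IsProbabilityMeasure gam1)
  set μ := volume.withDensity f with hμ
  have hac : μ ≪ volume := withDensity_absolutelyContinuous _ _
  have hm : Measurable (qt μ) := (qt_mono μ).measurable
  have h1 : ∀ᵐ y ∂μ, HasDerivAt (cdf μ) (f y).toReal y ∧ f y < ∞ :=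
    hac.ae_le ((ae_hasDerivAt_cdf f hf).and (ae_lt_top hf (by simp [hf1])))
  have h2 : ∀ᵐ x, HasDerivAt (cdf μ) (f (qt μ x)).toReal (qt μ x) ∧ f (qt μ x) < ∞ := by
    apply ac_gam1.ae_le
    have h1' := (Measure.QuasiMeasurePreserving.mk hm (map_qt μ hac).absolutelyContinuous).ae h1
    exact h1'
  filter_upwards [h2, (qt_mono μ).ae_differentiableAt, ae_hasDerivAt_cdf rho1 measurable_rho1]
    with x hx hd hr
  have hd' := hd.hasDerivAt
  rw [lowD_eq hd']
  have h3 := hx.1.comp x hd'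
  have h4 : (cdf μ) ∘ (qt μ) = cdf gam1 := by
    funext z; exact cdf_qt μ hac z
  rw [h4] at h3
  have h5 := h3.unique hr
  have h6 : (0 : ℝ) ≤ deriv (qt μ) x := (qt_mono μ).deriv_nonneg
  rw [← ENNReal.ofReal_toReal hx.2.ne, ← ENNReal.ofReal_mul h6, mul_comm, h5,
    ENNReal.ofReal_toReal (by simp [rho1])]

/-- Parametric one-dimensional transport. -/
lemma oneDim {α : Type*} [MeasurableSpace α] (k : α → ℝ → ℝ≥0∞)
    (hk : Measurable (Function.uncurry k)) (hk1 : ∀ a, ∫⁻ t, k a t = 1) :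
    ∃ T : α → ℝ → ℝ, Measurable (Function.uncurry T) ∧
      Measurable (Function.uncurry fun a => lowD (T a)) ∧
      (∀ a, Monotone (T a)) ∧
      (∀ a, ∀ φ : ℝ → ℝ≥0∞, Measurable φ → ∫⁻ x, rho1 x * φ (T a x) = ∫⁻ t, k a t * φ t) ∧
      (∀ a, ∀ᵐ x, lowD (T a) x * k a (T a x) = rho1 x) := by
  have hka : ∀ a, Measurable (k a) := fun a => hk.comp measurable_prodMk_left
  have hP : ∀ a, IsProbabilityMeasure (volume.withDensity (k a)) := fun a =>
    ⟨by rw [withDensity_apply _ MeasurableSet.univ]; simpa using hk1 a⟩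
  have hac : ∀ a, volume.withDensity (k a) ≪ volume := fun a =>
    withDensity_absolutelyContinuous _ _
  have hT : Measurable (Function.uncurry fun a => qt (volume.withDensity (k a))) := by
    apply measurable_of_Iic
    intro y
    have : (Function.uncurry fun a => qt (volume.withDensity (k a))) ⁻¹' Set.Iic y
        = {p : α × ℝ | ENNReal.ofReal (cdf gam1 p.2) ≤ ∫⁻ t in Set.Iic y, k p.1 t} := by
      ext ⟨a, x⟩
      have := hP a
      simp only [Set.mem_preimage, Function.uncurry_apply_pair, Set.mem_Iic, Set.mem_ofPred_eq]
      rw [qt_le_iff _ (hac a), ← withDensity_apply _ measurableSet_Iic, ← ofReal_cdf,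
        ENNReal.ofReal_le_ofReal_iff (cdf_nonneg _ _)]
    rw [this]
    apply measurableSet_le
    · exact ENNReal.measurable_ofReal.comp ((monotone_cdf gam1).measurable.comp measurable_snd)
    · have h1 : Measurable fun a => ∫⁻ t in Set.Iic y, k a t :=
        Measurable.lintegral_prod_right (f := k) hk
      exact h1.comp measurable_fst
  refine ⟨fun a => qt (volume.withDensity (k a)), hT, ?_, ?_, ?_, ?_⟩
  · apply Measurable.liminf
    intro n
    apply ENNReal.measurable_ofReal.comp
    apply Measurable.const_mul
    apply Measurable.sub
    · exact hT.comp (measurable_fst.prodMk (measurable_snd.add_const _))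
    · exact hT
  · intro a
    have := hP a
    exact qt_mono _
  · intro a φ hφ
    have := hP a
    have hm : Measurable (qt (volume.withDensity (k a))) := (qt_mono _).measurable
    have h1 := lintegral_withDensity_eq_lintegral_mul volume (hka a) hφ
    have h2 := lintegral_withDensity_eq_lintegral_mul volume measurable_rho1 (hφ.comp hm)
    simp only [Pi.mul_apply, Function.comp] at h1 h2
    rw [← h1, ← h2, ← gam1]
    conv_rhs => rw [← map_qt _ (hac a)]
    rw [lintegral_map hφ hm]
  · intro a
    exact qt_deriv (k a) (hka a) (hk1 a)

/-- One-dimensional change of variables inequality. -/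
lemma oneDim_cov (l : ℝ) (hl0 : 0 < l) (hl1 : l < 1) (T U : ℝ → ℝ) (hT : Monotone T)
    (hU : Monotone U) (v : ℝ) (g : ℝ → ℝ≥0∞) :
    ∫⁻ u, g (T (√l * u - √(1 - l) * v) + U (√(1 - l) * u + √l * v)) *
      (lowD T (√l * u - √(1 - l) * v) ^ l * lowD U (√(1 - l) * u + √l * v) ^ (1 - l))
      ≤ ENNReal.ofReal (√l ^ l * √(1 - l) ^ (1 - l)) * ∫⁻ z, g z := by
  set c := √l with hc
  set s := √(1 - l) with hs
  have hc0 : 0 < c := Real.sqrt_pos.2 hl0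
  have hs0 : 0 < s := Real.sqrt_pos.2 (by linarith)
  have hcc : c * c = l := Real.mul_self_sqrt hl0.le
  have hss : s * s = 1 - l := Real.mul_self_sqrt (by linarith)
  set Θ : ℝ → ℝ := fun u => T (c * u - s * v) + U (s * u + c * v) with hΘ
  have hΘm : Monotone Θ := by
    intro a b hab
    apply add_le_add
    · apply hT; nlinarith
    · apply hU; nlinarith
  have aeT : ∀ᵐ u, DifferentiableAt ℝ T (c * u - s * v) := by
    have : Measure.QuasiMeasurePreserving (fun u : ℝ => c * u - s * v) volume volume := by
      refine ⟨by fun_prop, ?_⟩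
      have h1 : (fun u : ℝ => c * u - s * v) = (fun u => u - s * v) ∘ (fun u => c * u) := rfl
      rw [h1, ← Measure.map_map (by fun_prop) (by fun_prop),
        Real.map_volume_mul_left hc0.ne', Measure.map_smul,
        (measurePreserving_sub_right volume (s * v)).map_eq]
      exact Measure.smul_absolutelyContinuous
    exact this.ae hT.ae_differentiableAt
  have aeU : ∀ᵐ u, DifferentiableAt ℝ U (s * u + c * v) := by
    have : Measure.QuasiMeasurePreserving (fun u : ℝ => s * u + c * v) volume volume := by
      refine ⟨by fun_prop, ?_⟩
      have h1 : (fun u : ℝ => s * u + c * v) = (fun u => u + c * v) ∘ (fun u => s * u) := rfl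
      rw [h1, ← Measure.map_map (by fun_prop) (by fun_prop),
        Real.map_volume_mul_left hs0.ne', Measure.map_smul,
        (measurePreserving_add_right volume (c * v)).map_eq]
      exact Measure.smul_absolutelyContinuous
    exact this.ae hU.ae_differentiableAt
  have hder : ∀ u, DifferentiableAt ℝ T (c * u - s * v) → DifferentiableAt ℝ U (s * u + c * v) →
      HasDerivAt Θ (deriv T (c * u - s * v) * c + deriv U (s * u + c * v) * s) u := by
    intro u h1 h2
    apply HasDerivAt.add
    · have := (((hasDerivAt_id u).const_mul c).sub_const (s * v))
      simp only [id, mul_one] at this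
      exact h1.hasDerivAt.comp u this
    · have := (((hasDerivAt_id u).const_mul s).add_const (c * v))
      simp only [id, mul_one] at this
      exact h2.hasDerivAt.comp u this
  set S : Set ℝ := {u | DifferentiableAt ℝ Θ u} with hS
  have hSm : MeasurableSet S := measurableSet_of_differentiableAt ℝ Θ
  have key : ∀ᵐ u, g (Θ u) *
      (lowD T (c * u - s * v) ^ l * lowD U (s * u + c * v) ^ (1 - l))
      ≤ ENNReal.ofReal (c ^ l * s ^ (1 - l)) *
        S.indicator (fun u => ENNReal.ofReal (deriv Θ u) * g (Θ u)) u := by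
    filter_upwards [aeT, aeU] with u h1 h2
    have h3 := hder u h1 h2
    have hmem : u ∈ S := h3.differentiableAt
    rw [Set.indicator_of_mem hmem, h3.deriv, lowD_eq h1.hasDerivAt, lowD_eq h2.hasDerivAt]
    have p1 : 0 ≤ deriv T (c * u - s * v) := hT.deriv_nonneg
    have p2 : 0 ≤ deriv U (s * u + c * v) := hU.deriv_nonneg
    generalize deriv T (c * u - s * v) = a at *
    generalize deriv U (s * u + c * v) = b at *
    rw [ENNReal.ofReal_rpow_of_nonneg p1 hl0.le, ENNReal.ofReal_rpow_of_nonneg p2 (by linarith),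
      ← ENNReal.ofReal_mul (by positivity), ← mul_assoc, ← ENNReal.ofReal_mul (by positivity),
      mul_comm]
    refine mul_le_mul_left (ENNReal.ofReal_le_ofReal ?_) _
    have am := Real.geom_mean_le_arith_mean2_weighted hl0.le (by linarith : 0 ≤ 1 - l)
      (div_nonneg p1 hc0.le) (div_nonneg p2 hs0.le) (by ring)
    rw [Real.div_rpow p1 hc0.le, Real.div_rpow p2 hs0.le] at am
    have e1 : l * (a / c) + (1 - l) * (b / s) = a * c + b * s := by
      have i1 : l * (a / c) = a * c := by
        rw [← hcc]; field_simp
      have i2 : (1 - l) * (b / s) = b * s := by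
        rw [← hss]; field_simp
      rw [i1, i2]
    rw [e1] at am
    have q1 : 0 < c ^ l := Real.rpow_pos_of_pos hc0 _
    have q2 : 0 < s ^ (1 - l) := Real.rpow_pos_of_pos hs0 _
    calc a ^ l * b ^ (1 - l)
        = c ^ l * s ^ (1 - l) * (a ^ l / c ^ l * (b ^ (1 - l) / s ^ (1 - l))) := by field_simp
      _ ≤ _ := by gcongr
  calc _ ≤ ∫⁻ u, ENNReal.ofReal (c ^ l * s ^ (1 - l)) *
        S.indicator (fun u => ENNReal.ofReal (deriv Θ u) * g (Θ u)) u := lintegral_mono_ae key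
    _ = ENNReal.ofReal (c ^ l * s ^ (1 - l)) *
        ∫⁻ u, S.indicator (fun u => ENNReal.ofReal (deriv Θ u) * g (Θ u)) u :=
        lintegral_const_mul' _ _ (by simp)
    _ ≤ _ := by
        refine mul_le_mul_right ?_ _
        rw [lintegral_indicator hSm, ← lintegral_image_eq_lintegral_deriv_mul_of_monotoneOn hSm
          (fun x hx => (DifferentiableAt.hasDerivAt hx).hasDerivWithinAt) (hΘm.monotoneOn S)]
        exact setLIntegral_le_lintegral _ _

end EPI

namespace EPI
open scoped ENNReal Topology

/-- `T` transports the density `ρ` to the density `f`, with Jacobian `J`. -/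
structure IsTr {E : Type*} [MeasurableSpace E] (vol : Measure E) (ρ f : E → ℝ≥0∞)
    (T : E → E) (J : E → ℝ≥0∞) : Prop where
  mT : Measurable T
  mJ : Measurable J
  push : ∀ φ : E → ℝ≥0∞, Measurable φ → ∫⁻ x, ρ x * φ (T x) ∂vol = ∫⁻ x, f x * φ x ∂vol
  jac : ∀ᵐ x ∂vol, J x * f (T x) = ρ x

/-- Change of variables inequality for a pair of transports. -/
def Cov {E : Type*} [MeasurableSpace E] [AddCommGroup E] [Module ℝ E] (vol : Measure E)
    (l : ℝ) (C : ℝ≥0∞) (T U : E → E) (J K : E → ℝ≥0∞) : Prop :=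
  ∀ (v : E) (g : E → ℝ≥0∞), Measurable g →
    ∫⁻ u, g (T (√l • u - √(1 - l) • v) + U (√(1 - l) • u + √l • v)) *
      (J (√l • u - √(1 - l) • v) ^ l * K (√(1 - l) • u + √l • v) ^ (1 - l)) ∂vol
      ≤ C * ∫⁻ z, g z ∂vol

/-- Existence of transports. -/
def HasTr (E : Type*) [MeasurableSpace E] [AddCommGroup E] [Module ℝ E] (vol : Measure E)
    (ρ : E → ℝ≥0∞) (l : ℝ) (C : ℝ≥0∞) : Prop :=
  ∀ f h : E → ℝ≥0∞, Measurable f → Measurable h → ∫⁻ x, f x ∂vol = 1 → ∫⁻ x, h x ∂vol = 1 →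
    ∃ (T U : E → E) (J K : E → ℝ≥0∞), IsTr vol ρ f T J ∧ IsTr vol ρ h U K ∧ Cov vol l C T U J K

section step
variable {E : Type*} [MeasurableSpace E] (vol : Measure E) [SigmaFinite vol]
  (ρ : E → ℝ≥0∞) (hρ : Measurable ρ) (hρ0 : ∀ x, ρ x ≠ 0) (hρt : ∀ x, ρ x ≠ ∞)

lemma exists_cond (f : ℝ × E → ℝ≥0∞) (hf : Measurable f) :
    ∃ k : E → ℝ → ℝ≥0∞, Measurable (Function.uncurry k) ∧ (∀ a, ∫⁻ t, k a t = 1) ∧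
      ∀ a, (∫⁻ t, f (t, a)) ≠ 0 → (∫⁻ t, f (t, a)) ≠ ∞ →
        ∀ t, k a t * (∫⁻ t, f (t, a)) = f (t, a) := by
  classical
  have hf1 : Measurable fun a => ∫⁻ t, f (t, a) := hf.lintegral_prod_left'
  refine ⟨fun a t => if (∫⁻ t, f (t, a)) = 0 ∨ (∫⁻ t, f (t, a)) = ∞ then rho1 t else
    f (t, a) / (∫⁻ t, f (t, a)), ?_, ?_, ?_⟩
  · apply Measurable.ite
    · apply MeasurableSet.union
      · exact (hf1.comp measurable_fst) (measurableSet_singleton 0)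
      · exact (hf1.comp measurable_fst) (measurableSet_singleton ∞)
    · exact measurable_rho1.comp measurable_snd
    · exact (hf.comp measurable_swap).div (hf1.comp measurable_fst)
  · intro a
    by_cases h : (∫⁻ t, f (t, a)) = 0 ∨ (∫⁻ t, f (t, a)) = ∞
    · simp only [h, if_true]; exact lintegral_rho1
    · simp only [h, if_false]
      push Not at h
      simp only [div_eq_mul_inv]
      have mfa : Measurable fun t => f (t, a) := hf.comp measurable_prodMk_right
      rw [lintegral_mul_const _ mfa, ENNReal.mul_inv_cancel h.1 h.2]
  · intro a h0 h1 t
    simp only [h0, h1, or_self, if_false]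
    exact ENNReal.div_mul_cancel h0 h1

include hρ hρ0 hρt in
lemma tr_step (f : ℝ × E → ℝ≥0∞) (hf : Measurable f) (hf1 : ∫⁻ p, f p ∂(volume.prod vol) = 1) :
    ∃ T2 : E → ℝ → ℝ, Measurable (Function.uncurry T2) ∧
      Measurable (Function.uncurry fun a => lowD (T2 a)) ∧ (∀ a, Monotone (T2 a)) ∧
      ∀ T1 J1, IsTr vol ρ (fun a => ∫⁻ t, f (t, a)) T1 J1 →
        IsTr (volume.prod vol) (fun p => rho1 p.1 * ρ p.2) f
          (fun p => (T2 (T1 p.2) p.1, T1 p.2)) (fun p => lowD (T2 (T1 p.2)) p.1 * J1 p.2) := by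
  obtain ⟨k, hk, hk1, hkf⟩ := exists_cond f hf
  obtain ⟨T2, mT2, mD, mono, push2, jac2⟩ := oneDim k hk hk1
  have mf1 : Measurable fun a => ∫⁻ t, f (t, a) := hf.lintegral_prod_left'
  refine ⟨T2, mT2, mD, mono, fun T1 J1 h => ?_⟩
  have mT : Measurable fun p : ℝ × E => (T2 (T1 p.2) p.1, T1 p.2) :=
    (mT2.comp ((h.mT.comp measurable_snd).prodMk measurable_fst)).prodMk (h.mT.comp measurable_snd)
  have mJ : Measurable fun p : ℝ × E => lowD (T2 (T1 p.2)) p.1 * J1 p.2 :=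
    (mD.comp ((h.mT.comp measurable_snd).prodMk measurable_fst)).mul (h.mJ.comp measurable_snd)
  have mρ : Measurable fun p : ℝ × E => rho1 p.1 * ρ p.2 :=
    (measurable_rho1.comp measurable_fst).mul (hρ.comp measurable_snd)
  refine ⟨mT, mJ, ?_, ?_⟩
  · intro φ hφ
    have mψ : Measurable fun b => ∫⁻ t, k b t * φ (t, b) := by
      apply Measurable.lintegral_prod_right (f := fun b t => k b t * φ (t, b))
      exact hk.mul (hφ.comp measurable_swap)
    have m1 : Measurable fun p : ℝ × E => rho1 p.1 * ρ p.2 * φ (T2 (T1 p.2) p.1, T1 p.2) :=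
      mρ.mul (hφ.comp mT)
    have m2 : Measurable fun p : ℝ × E => f p * φ p := hf.mul hφ
    rw [lintegral_prod_symm _ m1.aemeasurable, lintegral_prod_symm _ m2.aemeasurable]
    calc ∫⁻ b, ∫⁻ t, rho1 t * ρ b * φ (T2 (T1 b) t, T1 b) ∂volume ∂vol
        = ∫⁻ b, ρ b * (fun b => ∫⁻ t, k b t * φ (t, b)) (T1 b) ∂vol := by
          congr 1; ext b
          have := push2 (T1 b) (fun t => φ (t, T1 b)) (hφ.comp measurable_prodMk_right)
          simp only
          rw [← this, ← lintegral_const_mul]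
          · congr 1; ext t; ring
          · exact measurable_rho1.mul (hφ.comp (Measurable.prodMk ((mono _).measurable)
              measurable_const))
      _ = ∫⁻ b, (∫⁻ t, f (t, b)) * (∫⁻ t, k b t * φ (t, b)) ∂vol := h.push _ mψ
      _ = ∫⁻ b, ∫⁻ t, f (t, b) * φ (t, b) ∂volume ∂vol := by
          have hfin : ∀ᵐ b ∂vol, (∫⁻ t, f (t, b)) < ∞ := by
            apply ae_lt_top mf1
            rw [← lintegral_prod_symm _ hf.aemeasurable, hf1]; simp
          apply lintegral_congr_ae
          filter_upwards [hfin] with b hb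
          by_cases h0 : (∫⁻ t, f (t, b)) = 0
          · rw [h0, zero_mul]
            symm
            have mfb : Measurable fun t => f (t, b) := hf.comp measurable_prodMk_right
            have := (lintegral_eq_zero_iff mfb).1 h0
            rw [lintegral_congr_ae (g := fun _ => 0)]
            · simp
            · filter_upwards [this] with t ht
              simp only [Pi.zero_apply] at ht
              simp [ht]
          · rw [← lintegral_const_mul']
            · congr 1; ext t
              rw [← mul_assoc, mul_comm _ (k b t), hkf b h0 hb.ne]
            · exact hb.ne
  · have : MeasurableSet {p : ℝ × E | lowD (T2 (T1 p.2)) p.1 * J1 p.2 *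
        f (T2 (T1 p.2) p.1, T1 p.2) = rho1 p.1 * ρ p.2} :=
      measurableSet_eq_fun (mJ.mul (hf.comp mT)) mρ
    rw [Measure.ae_prod_iff_ae_ae this, Measure.ae_ae_comm this]
    filter_upwards [h.jac] with b hb
    have g0 : (∫⁻ t, f (t, T1 b)) ≠ 0 := by
      intro h0; rw [h0, mul_zero] at hb; exact hρ0 b hb.symm
    have g1 : (∫⁻ t, f (t, T1 b)) ≠ ∞ := by
      intro h0; rw [h0] at hb
      by_cases hJ : J1 b = 0
      · rw [hJ, zero_mul] at hb; exact hρ0 b hb.symm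
      · rw [ENNReal.mul_top hJ] at hb; exact hρt b hb.symm
    filter_upwards [jac2 (T1 b)] with t ht
    rw [← hkf (T1 b) g0 g1, ← ht, ← hb]
    ring

variable [AddCommGroup E] [Module ℝ E] [MeasurableAdd₂ E] [MeasurableSub₂ E]
  [MeasurableConstSMul ℝ E]

include hρ hρ0 hρt in
lemma hasTr_step (l : ℝ) (hl0 : 0 < l) (hl1 : l < 1) (C : ℝ≥0∞) (h : HasTr E vol ρ l C) :
    HasTr (ℝ × E) (volume.prod vol) (fun p => rho1 p.1 * ρ p.2) l
      (ENNReal.ofReal (√l ^ l * √(1 - l) ^ (1 - l)) * C) := by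
  intro f h mf mh hf1 hh1
  obtain ⟨T2, mT2, mDT, monoT, HT⟩ := tr_step vol ρ hρ hρ0 hρt f mf hf1
  obtain ⟨U2, mU2, mDU, monoU, HU⟩ := tr_step vol ρ hρ hρ0 hρt h mh hh1
  obtain ⟨T1, U1, J1, K1, t1, u1, cov1⟩ := ‹HasTr E vol ρ l C› (fun a => ∫⁻ t, f (t, a))
    (fun a => ∫⁻ t, h (t, a)) mf.lintegral_prod_left' mh.lintegral_prod_left'
    (by rw [← lintegral_prod_symm _ mf.aemeasurable, hf1])
    (by rw [← lintegral_prod_symm _ mh.aemeasurable, hh1])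
  have t2 := HT T1 J1 t1
  have u2 := HU U1 K1 u1
  refine ⟨_, _, _, _, t2, u2, ?_⟩
  rintro ⟨v1, v2⟩ g hg
  have mx : Measurable fun u : ℝ × E => √l • u - √(1 - l) • (v1, v2) :=
    Measurable.prodMk (f := fun u : ℝ × E => √l • u.1 - √(1 - l) • v1)
      (g := fun u : ℝ × E => √l • u.2 - √(1 - l) • v2)
      (Measurable.sub_const (f := fun u : ℝ × E => _ • u.1) (by fun_prop) _)
      (Measurable.sub_const (f := fun u : ℝ × E => _ • u.2) ((measurable_const_smul _).comp measurable_snd) _)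
  have my : Measurable fun u : ℝ × E => √(1 - l) • u + √l • (v1, v2) :=
    Measurable.prodMk (f := fun u : ℝ × E => √(1 - l) • u.1 + √l • v1)
      (g := fun u : ℝ × E => √(1 - l) • u.2 + √l • v2)
      (Measurable.add_const (f := fun u : ℝ × E => _ • u.1) (by fun_prop) _)
      (Measurable.add_const (f := fun u : ℝ × E => _ • u.2) ((measurable_const_smul _).comp measurable_snd) _)
  have madd : ∀ A B : ℝ × E → ℝ × E, Measurable A → Measurable B →
      Measurable fun u => A u + B u := fun A B hA hB =>
    Measurable.prodMk (f := fun u : ℝ × E => (A u).1 + (B u).1)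
      (g := fun u : ℝ × E => (A u).2 + (B u).2)
      (hA.fst.add hB.fst) (hA.snd.add hB.snd)
  rw [lintegral_prod_symm]
  swap
  · apply Measurable.aemeasurable
    exact (hg.comp (madd _ _ (t2.mT.comp mx) (u2.mT.comp my))).mul
      (((t2.mJ.comp mx).pow_const _).mul ((u2.mJ.comp my).pow_const _))
  have hl1' : 0 ≤ 1 - l := by linarith
  rw [lintegral_prod_symm _ hg.aemeasurable, mul_assoc]
  refine le_trans ?_ (mul_le_mul_right (cov1 v2 (fun b => ∫⁻ t, g (t, b))
    hg.lintegral_prod_left') _)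
  rw [← lintegral_const_mul' _ _ (by simp)]
  apply lintegral_mono
  intro b
  simp only [Prod.smul_mk, Prod.mk_add_mk, Prod.mk_sub_mk, smul_eq_mul]
  set xb := √l • b - √(1 - l) • v2
  set yb := √(1 - l) • b + √l • v2
  have key := oneDim_cov l hl0 hl1 (T2 (T1 xb)) (U2 (U1 yb)) (monoT _) (monoU _) v1
    (fun t => g (t, T1 xb + U1 yb))
  rw [← mul_assoc]
  have key2 := mul_le_mul_left key (J1 xb ^ l * K1 yb ^ (1 - l))
  refine le_trans (le_of_eq ?_) key2
  rw [← lintegral_mul_const]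
  · congr 1; ext t
    rw [ENNReal.mul_rpow_of_nonneg _ _ hl0.le, ENNReal.mul_rpow_of_nonneg _ _ hl1']
    ring
  · have a1 : Measurable fun t : ℝ => √l * t - √(1 - l) * v1 := by fun_prop
    have a2 : Measurable fun t : ℝ => √(1 - l) * t + √l * v1 := by fun_prop
    have b1 : Measurable (lowD (T2 (T1 xb))) :=
      Measurable.comp (g := Function.uncurry fun a => lowD (T2 a)) (f := Prod.mk (T1 xb)) mDT measurable_prodMk_left
    have b2 : Measurable (lowD (U2 (U1 yb))) :=
      Measurable.comp (g := Function.uncurry fun a => lowD (U2 a)) (f := Prod.mk (U1 yb)) mDU measurable_prodMk_left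
    have c1 : Measurable fun t => lowD (T2 (T1 xb)) (√l * t - √(1 - l) * v1) := b1.comp a1
    have c2 : Measurable fun t => lowD (U2 (U1 yb)) (√(1 - l) * t + √l * v1) := b2.comp a2
    have c3 : Measurable fun t => T2 (T1 xb) (√l * t - √(1 - l) * v1) :=
      (monoT _).measurable.comp a1
    have c4 : Measurable fun t => U2 (U1 yb) (√(1 - l) * t + √l * v1) :=
      (monoU _).measurable.comp a2
    exact Measurable.mul (hg.comp ((c3.add c4).prodMk measurable_const))
      ((c1.pow_const l).mul (c2.pow_const (1 - l)))

end step

lemma hasTr_transfer {E E' : Type*} [MeasurableSpace E] [AddCommGroup E] [Module ℝ E]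
    [MeasurableSpace E'] [AddCommGroup E'] [Module ℝ E'] (vol : Measure E) (vol' : Measure E')
    (ρ : E → ℝ≥0∞) (l : ℝ) (C : ℝ≥0∞) (e : E' ≃ᵐ E) (he : MeasurePreserving e vol' vol)
    (hadd : ∀ x y, e (x + y) = e x + e y) (hsmul : ∀ (c : ℝ) x, e (c • x) = c • e x)
    (h : HasTr E vol ρ l C) : HasTr E' vol' (fun x => ρ (e x)) l C := by
  have hes : MeasurePreserving e.symm vol vol' := he.symm e
  have hsub : ∀ x y, e (x - y) = e x - e y := by
    intro x y
    rw [eq_sub_iff_add_eq, ← hadd, sub_add_cancel]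
  have hadd' : ∀ x y, e.symm (x + y) = e.symm x + e.symm y := by
    intro x y
    apply e.injective
    simp [hadd]
  have conv : ∀ F : E' → ℝ≥0∞, ∫⁻ x, F (e.symm x) ∂vol = ∫⁻ x, F x ∂vol' := fun F =>
    hes.lintegral_comp_emb e.symm.measurableEmbedding F
  have conv' : ∀ F : E → ℝ≥0∞, ∫⁻ x, F (e x) ∂vol' = ∫⁻ x, F x ∂vol := fun F =>
    he.lintegral_comp_emb e.measurableEmbedding F
  have tr : ∀ f T J, IsTr vol ρ (fun x => f (e.symm x)) T J →
      IsTr vol' (fun x => ρ (e x)) f (fun x => e.symm (T (e x))) (fun x => J (e x)) := by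
    intro f T J t
    refine ⟨e.symm.measurable.comp (t.mT.comp e.measurable), t.mJ.comp e.measurable, ?_, ?_⟩
    · intro φ hφ
      rw [conv' (fun x => ρ x * φ (e.symm (T x))), ← conv (fun x => f x * φ x)]
      exact t.push (fun x => φ (e.symm x)) (hφ.comp e.symm.measurable)
    · exact he.quasiMeasurePreserving.ae t.jac
  intro f h' mf mh hf1 hh1
  obtain ⟨T, U, J, K, t, u, cov⟩ := h (fun x => f (e.symm x)) (fun x => h' (e.symm x))
    (mf.comp e.symm.measurable) (mh.comp e.symm.measurable)
    (by rw [conv, hf1]) (by rw [conv, hh1])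
  refine ⟨_, _, _, _, tr f T J t, tr h' U K u, ?_⟩
  intro v g hg
  have := cov (e v) (fun x => g (e.symm x)) (hg.comp e.symm.measurable)
  rw [conv g, ← conv'] at this
  simpa only [hadd, hsub, hsmul, hadd'] using this

lemma hasTr_zero (l : ℝ) : HasTr (Fin 0 → ℝ) volume (fun _ => 1) l 1 := by
  have key : ∀ f : (Fin 0 → ℝ) → ℝ≥0∞, Measurable f → ∫⁻ x, f x = 1 →
      IsTr volume (fun _ => 1) f id (fun _ => 1) := by
    intro f mf hf
    have h1 : ∀ x, f x = 1 := by
      intro x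
      rw [volume_pi, Measure.pi_of_empty _ x] at hf
      simpa [lintegral_dirac' _ mf] using hf
    refine ⟨measurable_id, measurable_const, ?_, ?_⟩
    · intro φ _; simp [h1]
    · simp [h1]
  intro f h mf mh hf hh
  refine ⟨_, _, _, _, key f mf hf, key h mh hh, ?_⟩
  intro v g hg
  simp only [ENNReal.one_rpow, mul_one, one_mul]
  apply le_of_eq
  congr 1; ext u
  congr 1
  exact Subsingleton.elim _ _

/-- Gaussian density on `Fin n → ℝ`. -/
def rhoPi (n : ℕ) (x : Fin n → ℝ) : ℝ≥0∞ := ENNReal.ofReal (Real.exp (-π * ∑ i, x i ^ 2))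

lemma hasTr_pi (l : ℝ) (hl0 : 0 < l) (hl1 : l < 1) (n : ℕ) :
    HasTr (Fin n → ℝ) volume (rhoPi n) l (ENNReal.ofReal (√l ^ l * √(1 - l) ^ (1 - l)) ^ n) := by
  induction n with
  | zero =>
    have h := hasTr_zero l
    have : rhoPi 0 = fun _ => 1 := by ext x; simp [rhoPi]
    rw [this, pow_zero]; exact h
  | succ n ih =>
    have mρ : Measurable (rhoPi n) := by unfold rhoPi; fun_prop
    have h1 := hasTr_step volume (rhoPi n) mρ (fun x => by simp [rhoPi, Real.exp_pos])
      (fun x => by simp [rhoPi]) l hl0 hl1 _ ih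
    have h2 := hasTr_transfer _ _ _ l _ _
      (volume_preserving_piFinSuccAbove (fun _ : Fin (n + 1) => ℝ) 0)
      (fun x y => rfl) (fun c x => rfl) h1
    rw [pow_succ']
    have hr : rhoPi (n + 1) = fun x =>
        rho1 ((MeasurableEquiv.piFinSuccAbove (fun _ : Fin (n + 1) => ℝ) 0) x).1 *
        rhoPi n ((MeasurableEquiv.piFinSuccAbove (fun _ : Fin (n + 1) => ℝ) 0) x).2 := by
     funext x
     simp only [rho1, rhoPi]
     rw [← ENNReal.ofReal_mul (Real.exp_pos _).le, ← Real.exp_add, Fin.sum_univ_succ]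
     congr 2
     simp [MeasurableEquiv.piFinSuccAbove, Fin.tail]
     ring
    rw [hr]
    exact h2

/-- Gaussian density on Euclidean space. -/
def rhoE (n : ℕ) (x : EuclideanSpace ℝ (Fin n)) : ℝ≥0∞ :=
  ENNReal.ofReal (Real.exp (-π * ‖x‖ ^ 2))

lemma hasTr_euclidean (l : ℝ) (hl0 : 0 < l) (hl1 : l < 1) (n : ℕ) :
    HasTr (EuclideanSpace ℝ (Fin n)) volume (rhoE n) l
      (ENNReal.ofReal (√l ^ l * √(1 - l) ^ (1 - l)) ^ n) := by
  have h2 := hasTr_transfer _ _ _ l _ _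
      (EuclideanSpace.volume_preserving_symm_measurableEquiv_toLp (Fin n))
      (fun x y => rfl) (fun c x => rfl) (hasTr_pi l hl0 hl1 n)
  have hr : rhoE n = fun x => rhoPi n ((MeasurableEquiv.toLp 2 (Fin n → ℝ)).symm x) := by
    funext x
    simp [rhoE, rhoPi, EuclideanSpace.norm_sq_eq]
  rw [hr]
  exact h2

end EPI

namespace EPI
open scoped ENNReal Topology

section main
variable {n : ℕ}

lemma norm_rot {E : Type*} [NormedAddCommGroup E] [InnerProductSpace ℝ E] (c s : ℝ)
    (h : c ^ 2 + s ^ 2 = 1) (x y : E) :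
    ‖c • x - s • y‖ ^ 2 + ‖s • x + c • y‖ ^ 2 = ‖x‖ ^ 2 + ‖y‖ ^ 2 := by
  rw [norm_sub_sq_real, norm_add_sq_real]
  simp only [norm_smul, inner_smul_left, inner_smul_right, mul_pow, Real.norm_eq_abs, sq_abs]
  simp only [conj_trivial]
  linear_combination (‖x‖ ^ 2 + ‖y‖ ^ 2) * h

lemma rot_preserving (c s : ℝ) (h : c ^ 2 + s ^ 2 = 1) :
    MeasurePreserving (fun p : EuclideanSpace ℝ (Fin n) × EuclideanSpace ℝ (Fin n) =>
      (c • p.1 - s • p.2, s • p.1 + c • p.2)) (volume.prod volume) (volume.prod volume) := by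
  let E := EuclideanSpace ℝ (Fin n)
  let L : WithLp 2 (E × E) →ₗᵢ[ℝ] WithLp 2 (E × E) :=
    { toFun := fun p => WithLp.toLp 2 (c • p.fst - s • p.snd, s • p.fst + c • p.snd)
      map_add' := by
        intro p q
        rw [← WithLp.toLp_add]
        congr 1
        ext1 <;> simp <;> module
      map_smul' := by
        intro a p
        simp only [RingHom.id_apply]
        rw [← WithLp.toLp_smul]
        congr 1
        ext1 <;> simp <;> module
      norm_map' := by
        intro p
        rw [← sq_eq_sq₀ (norm_nonneg _) (norm_nonneg _)]
        simp only [LinearMap.coe_mk, AddHom.coe_mk]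
        rw [WithLp.prod_norm_sq_eq_of_L2, WithLp.prod_norm_sq_eq_of_L2]
        exact norm_rot c s h _ _ }
  have h1 := (L.toLinearIsometryEquiv rfl).measurePreserving
  have h2 := (WithLp.volume_preserving_ofLp E E).comp
    (h1.comp (WithLp.volume_preserving_toLp E E))
  exact h2

lemma rhoE_ne_zero (x : EuclideanSpace ℝ (Fin n)) : rhoE n x ≠ 0 := by
  simp [rhoE, Real.exp_pos]

lemma rhoE_ne_top (x : EuclideanSpace ℝ (Fin n)) : rhoE n x ≠ ∞ := by
  simp [rhoE]

lemma measurable_rhoE : Measurable (rhoE n) := by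
  unfold rhoE; fun_prop

lemma integrable_gauss {b : ℝ} (hb : 0 < b) :
    Integrable (fun x : EuclideanSpace ℝ (Fin n) => Real.exp (-b * ‖x‖ ^ 2)) := by
  by_contra h
  have h1 := GaussianFourier.integral_rexp_neg_mul_sq_norm (V := EuclideanSpace ℝ (Fin n)) hb
  rw [integral_undef h] at h1
  have : 0 < (π / b) ^ (Module.finrank ℝ (EuclideanSpace ℝ (Fin n)) / 2 : ℝ) := by positivity
  linarith

lemma lintegral_rhoE : ∫⁻ x, rhoE n x = 1 := by
  unfold rhoE
  rw [← ofReal_integral_eq_lintegral_ofReal (integrable_gauss Real.pi_pos)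
    (Eventually.of_forall fun x => (Real.exp_pos _).le),
    GaussianFourier.integral_rexp_neg_mul_sq_norm Real.pi_pos]
  simp [Real.pi_ne_zero]

/-- Gaussian measure on Euclidean space. -/
def gamE (n : ℕ) : Measure (EuclideanSpace ℝ (Fin n)) := volume.withDensity (rhoE n)

instance : IsProbabilityMeasure (gamE n) :=
  ⟨by rw [gamE, withDensity_apply _ MeasurableSet.univ]; simpa using lintegral_rhoE⟩

lemma integrable_norm_sq : Integrable (fun x => ‖x‖ ^ 2) (gamE n) := by
  rw [gamE, integrable_withDensity_iff measurable_rhoE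
    (Eventually.of_forall fun x => (rhoE_ne_top x).lt_top)]
  have hb : 0 < π - 1 := by linarith [Real.pi_gt_three]
  refine (integrable_gauss hb).mono' ?_ ?_
  · apply Measurable.aestronglyMeasurable
    exact Measurable.mul (by fun_prop) measurable_rhoE.ennreal_toReal
  · refine Eventually.of_forall fun x => ?_
    rw [rhoE, ENNReal.toReal_ofReal (Real.exp_pos _).le, Real.norm_of_nonneg (by positivity)]
    have h1 : ‖x‖ ^ 2 ≤ Real.exp (‖x‖ ^ 2) := by
      linarith [Real.add_one_le_exp (‖x‖ ^ 2)]
    calc ‖x‖ ^ 2 * Real.exp (-π * ‖x‖ ^ 2) ≤ Real.exp (‖x‖ ^ 2) * Real.exp (-π * ‖x‖ ^ 2) := by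
          gcongr
      _ = _ := by rw [← Real.exp_add]; ring_nf

lemma integrable_inner :
    Integrable (fun p : EuclideanSpace ℝ (Fin n) × EuclideanSpace ℝ (Fin n) => inner ℝ p.1 p.2)
      ((gamE n).prod (gamE n)) := by
  have h1 : Integrable (fun p : EuclideanSpace ℝ (Fin n) × EuclideanSpace ℝ (Fin n) => ‖p.1‖ ^ 2)
      ((gamE n).prod (gamE n)) := integrable_norm_sq.comp_fst _
  have h2 : Integrable (fun p : EuclideanSpace ℝ (Fin n) × EuclideanSpace ℝ (Fin n) => ‖p.2‖ ^ 2)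
      ((gamE n).prod (gamE n)) := integrable_norm_sq.comp_snd _
  refine (h1.add h2).mono' (Measurable.aestronglyMeasurable (by fun_prop)) ?_
  refine Eventually.of_forall fun p => ?_
  have := abs_real_inner_le_norm p.1 p.2
  simp only [Real.norm_eq_abs, Pi.add_apply]
  nlinarith [sq_nonneg (‖p.1‖ - ‖p.2‖), sq_nonneg (‖p.1‖), sq_nonneg (‖p.2‖)]

lemma map_neg_gamE : Measure.map (fun x => -x) (gamE n) = gamE n := by
  ext s hs
  rw [Measure.map_apply measurable_neg hs, gamE, withDensity_apply _ (measurable_neg hs),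
    withDensity_apply _ hs, ← lintegral_indicator (measurable_neg hs), ← lintegral_indicator hs]
  rw [← (Measure.measurePreserving_neg (volume : Measure (EuclideanSpace ℝ (Fin n)))).lintegral_comp
    (measurable_rhoE.indicator hs)]
  refine lintegral_congr fun x => ?_
  by_cases hx : -x ∈ s
  · have hx' : x ∈ (fun x => -x) ⁻¹' s := hx
    rw [Set.indicator_of_mem hx, Set.indicator_of_mem hx']
    simp [rhoE]
  · have hx' : x ∉ (fun x => -x) ⁻¹' s := hx
    rw [Set.indicator_of_notMem hx, Set.indicator_of_notMem hx']

lemma integral_inner :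
    ∫ p : EuclideanSpace ℝ (Fin n) × EuclideanSpace ℝ (Fin n), inner ℝ p.1 p.2
      ∂((gamE n).prod (gamE n)) = 0 := by
  rw [integral_prod _ integrable_inner]
  have : ∀ x : EuclideanSpace ℝ (Fin n), ∫ y, inner ℝ x y ∂(gamE n) = 0 := by
    intro x
    have h1 : ∫ y, inner ℝ x y ∂(gamE n) = - ∫ y, inner ℝ x y ∂(gamE n) := by
      conv_lhs => rw [← map_neg_gamE]
      rw [integral_map measurable_neg.aemeasurable
        (Measurable.aestronglyMeasurable (by fun_prop))]
      simp only [inner_neg_right]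
      rw [integral_neg]
    linarith
  simp [this]

lemma prod_gamE : (gamE n).prod (gamE n) =
    (volume.prod volume).withDensity (fun p => rhoE n p.1 * rhoE n p.2) :=
  prod_withDensity measurable_rhoE measurable_rhoE

lemma IsTr.map_eq {f : EuclideanSpace ℝ (Fin n) → ℝ≥0∞} {T J}
    (h : IsTr volume (rhoE n) f T J) :
    Measure.map T (gamE n) = volume.withDensity f := by
  ext s hs
  rw [Measure.map_apply h.mT hs, gamE, withDensity_apply _ (h.mT hs), withDensity_apply _ hs,
    ← lintegral_indicator (h.mT hs), ← lintegral_indicator hs]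
  have := h.push (s.indicator 1) (measurable_one.indicator hs)
  calc _ = _ := lintegral_congr fun x => ?_
    _ = _ := this
    _ = _ := lintegral_congr fun x => ?_
  · by_cases hx : T x ∈ s <;> simp [Set.indicator, hx]
  · by_cases hx : x ∈ s <;> simp [Set.indicator, hx]

/-- Core exponential-moment bound. -/
lemma core (l : ℝ) (C : ℝ≥0∞) (hl0 : 0 < l) (hl1 : l < 1)
    {f h g : EuclideanSpace ℝ (Fin n) → ℝ≥0∞} {T U J K}
    (ht : IsTr volume (rhoE n) f T J) (hu : IsTr volume (rhoE n) h U K)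
    (hcov : Cov volume l C T U J K) (mg : Measurable g) (hg1 : ∫⁻ x, g x = 1)
    (hgpos : ∀ᵐ p ∂((gamE n).prod (gamE n)), g (T p.1 + U p.2) ≠ 0 ∧ g (T p.1 + U p.2) ≠ ∞) :
    ∫⁻ p, ENNReal.ofReal (Real.exp (Real.log (g (T p.1 + U p.2)).toReal
      - l * Real.log (f (T p.1)).toReal - (1 - l) * Real.log (h (U p.2)).toReal
      + 2 * π * (√l * √(1 - l)) * inner ℝ p.1 p.2)) ∂((gamE n).prod (gamE n)) ≤ C := by
  have hl1' : 0 < 1 - l := by linarith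
  have hcc : √l ^ 2 = l := Real.sq_sqrt hl0.le
  have hss : √(1 - l) ^ 2 = 1 - l := Real.sq_sqrt hl1'.le
  set c := √l with hc
  set s := √(1 - l) with hs
  have hcs : c ^ 2 + s ^ 2 = 1 := by rw [hcc, hss]; ring
  have mρ2 : Measurable fun p : EuclideanSpace ℝ (Fin n) × EuclideanSpace ℝ (Fin n) =>
      rhoE n p.1 * rhoE n p.2 :=
    (measurable_rhoE.comp measurable_fst).mul (measurable_rhoE.comp measurable_snd)
  have hac : (volume.prod volume : Measure (EuclideanSpace ℝ (Fin n) × EuclideanSpace ℝ (Fin n)))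
      ≪ (gamE n).prod (gamE n) := by
    rw [prod_gamE]
    exact withDensity_absolutelyContinuous' mρ2.aemeasurable
      (Eventually.of_forall fun p => mul_ne_zero (rhoE_ne_zero _) (rhoE_ne_zero _))
  have good : ∀ {a b : ℝ≥0∞} {x : EuclideanSpace ℝ (Fin n)}, a * b = rhoE n x →
      a = ENNReal.ofReal (Real.exp (-π * ‖x‖ ^ 2 - Real.log b.toReal)) := by
    intro a b x hab
    have b0 : b ≠ 0 := by
      rintro rfl; rw [mul_zero] at hab; exact rhoE_ne_zero x hab.symm
    have b1 : b ≠ ∞ := by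
      rintro rfl
      by_cases ha : a = 0
      · rw [ha, zero_mul] at hab; exact rhoE_ne_zero x hab.symm
      · rw [ENNReal.mul_top ha] at hab; exact rhoE_ne_top x hab.symm
    have bp : 0 < b.toReal := ENNReal.toReal_pos b0 b1
    rw [Real.exp_sub, Real.exp_log bp, ENNReal.ofReal_div_of_pos bp, ENNReal.ofReal_toReal b1,
      ENNReal.eq_div_iff b0 b1, mul_comm, hab, rhoE]
  set G : EuclideanSpace ℝ (Fin n) × EuclideanSpace ℝ (Fin n) → ℝ≥0∞ := fun p =>
    g (T p.1 + U p.2) * (J p.1 ^ l * K p.2 ^ (1 - l)) * rhoE n (c • p.2 - s • p.1) with hG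
  have mG : Measurable G := by
    refine Measurable.mul (Measurable.mul ?_ (Measurable.mul ?_ ?_)) ?_
    · exact mg.comp ((ht.mT.comp measurable_fst).add (hu.mT.comp measurable_snd))
    · exact (ht.mJ.comp measurable_fst).pow_const _
    · exact (hu.mJ.comp measurable_snd).pow_const _
    · exact measurable_rhoE.comp (by fun_prop)
  calc _ ≤ ∫⁻ p, (rhoE n p.1 * rhoE n p.2) * ENNReal.ofReal (Real.exp
        (Real.log (g (T p.1 + U p.2)).toReal
      - l * Real.log (f (T p.1)).toReal - (1 - l) * Real.log (h (U p.2)).toReal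
      + 2 * π * (c * s) * inner ℝ p.1 p.2)) ∂(volume.prod volume) := by
        rw [prod_gamE]
        exact lintegral_withDensity_le_lintegral_mul _ mρ2 _
    _ = ∫⁻ p, G p ∂(volume.prod volume) := by
        apply lintegral_congr_ae
        filter_upwards [hac.ae_le hgpos, Measure.quasiMeasurePreserving_fst.ae ht.jac,
          Measure.quasiMeasurePreserving_snd.ae hu.jac] with p hp1 hp2 hp3
        simp only [hG]
        rw [good hp2, good hp3]
        have gp : 0 < (g (T p.1 + U p.2)).toReal := ENNReal.toReal_pos hp1.1 hp1.2
        have e1 : g (T p.1 + U p.2)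
            = ENNReal.ofReal (Real.exp (Real.log (g (T p.1 + U p.2)).toReal)) := by
          rw [Real.exp_log gp, ENNReal.ofReal_toReal hp1.2]
        conv_rhs => rw [e1]
        rw [ENNReal.ofReal_rpow_of_nonneg (Real.exp_pos _).le hl0.le,
          ENNReal.ofReal_rpow_of_nonneg (Real.exp_pos _).le hl1'.le, ← Real.exp_mul,
          ← Real.exp_mul]
        simp only [rhoE]
        rw [← ENNReal.ofReal_mul (Real.exp_pos _).le, ← Real.exp_add,
          ← ENNReal.ofReal_mul (Real.exp_pos _).le, ← Real.exp_add,
          ← ENNReal.ofReal_mul (Real.exp_pos _).le, ← Real.exp_add,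
          ← ENNReal.ofReal_mul (Real.exp_pos _).le, ← Real.exp_add,
          ← ENNReal.ofReal_mul (Real.exp_pos _).le, ← Real.exp_add]
        congr 2
        rw [norm_sub_sq_real]
        simp only [norm_smul, inner_smul_left, inner_smul_right, mul_pow, Real.norm_eq_abs, sq_abs]
        simp only [conj_trivial, hcc, hss]
        rw [real_inner_comm p.1 p.2]
        ring
    _ = ∫⁻ p, G (c • p.1 - s • p.2, s • p.1 + c • p.2) ∂(volume.prod volume) :=
        ((rot_preserving c s hcs).lintegral_comp mG).symm
    _ = ∫⁻ v, ∫⁻ u, G (c • u - s • v, s • u + c • v) := by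
        rw [lintegral_prod_symm]
        exact (mG.comp (rot_preserving c s hcs).measurable).aemeasurable
    _ ≤ ∫⁻ v, C * rhoE n v := by
        apply lintegral_mono
        intro v
        have h1 := hcov v g mg
        rw [hg1, mul_one] at h1
        refine le_trans (le_of_eq ?_) (mul_le_mul_left h1 (rhoE n v))
        rw [← lintegral_mul_const' _ _ (rhoE_ne_top v)]
        refine lintegral_congr fun u => ?_
        simp only [hG]
        congr 2
        have : c • (s • u + c • v) - s • (c • u - s • v) = (c ^ 2 + s ^ 2) • v := by module
        rw [this, hcs, one_smul]
    _ = C := by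
        rw [lintegral_const_mul _ measurable_rhoE, lintegral_rhoE, mul_one]

end main
end EPI

namespace EPI
open scoped ENNReal Topology

lemma entropy_facts {E : Type*} [MeasurableSpace E] (vol μ : Measure E) [SigmaFinite vol]
    [IsProbabilityMeasure μ] (hμ : μ ≪ vol) (h : HasFiniteEntropy vol μ) :
    Integrable (fun x => Real.log (μ.rnDeriv vol x).toReal) μ ∧
      diffEntropy vol μ = - ∫ x, Real.log (μ.rnDeriv vol x).toReal ∂μ ∧
      ∫⁻ x, μ.rnDeriv vol x ∂vol = 1 := by
  refine ⟨(integrable_rnDeriv_smul_iff hμ).1 h, ?_, ?_⟩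
  · rw [diffEntropy, ← integral_rnDeriv_smul hμ]; rfl
  · rw [Measure.lintegral_rnDeriv hμ, measure_univ]

lemma log_bound {α : Type*} [MeasurableSpace α] (P : Measure α) [IsProbabilityMeasure P]
    (L : α → ℝ) (hL : Integrable L P) (D : ℝ) (hD : 0 < D)
    (h : ∫⁻ p, ENNReal.ofReal (Real.exp (L p)) ∂P ≤ ENNReal.ofReal D) :
    ∫ p, L p ∂P ≤ Real.log D := by
  have hm : AEStronglyMeasurable (fun p => Real.exp (L p)) P :=
    Real.continuous_exp.comp_aestronglyMeasurable hL.1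
  have hi : Integrable (fun p => Real.exp (L p)) P := by
    refine ⟨hm, ?_⟩
    rw [hasFiniteIntegral_iff_ofReal (Eventually.of_forall fun p => (Real.exp_pos _).le)]
    exact h.trans_lt ENNReal.ofReal_lt_top
  have h1 : ∫ p, Real.exp (L p) ∂P ≤ D := by
    rw [← ENNReal.ofReal_le_ofReal_iff hD.le, ofReal_integral_eq_lintegral_ofReal hi
      (Eventually.of_forall fun p => (Real.exp_pos _).le)]
    exact h
  have h2 : ∀ p, L p ≤ Real.exp (L p) / D - 1 + Real.log D := by
    intro p
    have := Real.add_one_le_exp (L p - Real.log D)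
    rw [Real.exp_sub, Real.exp_log hD] at this
    linarith
  calc ∫ p, L p ∂P ≤ ∫ p, (Real.exp (L p) / D - 1 + Real.log D) ∂P :=
        integral_mono hL (((hi.div_const D).sub (integrable_const _)).add (integrable_const _)) h2
    _ = (∫ p, Real.exp (L p) ∂P) / D - 1 + Real.log D := by
        have a1 := integral_add ((hi.div_const D).sub (integrable_const (1 : ℝ)))
          (integrable_const (μ := P) (Real.log D))
        have a2 := integral_sub (hi.div_const D) (integrable_const (μ := P) (1 : ℝ))
        simp only [Pi.sub_apply] at a1
        rw [a1, a2, integral_div]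
        simp
    _ ≤ Real.log D := by
        have : (∫ p, Real.exp (L p) ∂P) / D ≤ 1 := by rw [div_le_one hD]; exact h1
        linarith

variable {n : ℕ}

/-- Linearized entropy power inequality. -/
lemma epi_lin (l : ℝ) (hl0 : 0 < l) (hl1 : l < 1) (μ ν : Measure (EuclideanSpace ℝ (Fin n)))
    [IsProbabilityMeasure μ] [IsProbabilityMeasure ν] (hμ : μ ≪ volume) (hν : ν ≪ volume)
    (eμ : HasFiniteEntropy volume μ) (eν : HasFiniteEntropy volume ν)
    (eS : HasFiniteEntropy volume (Measure.conv μ ν)) :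
    l * diffEntropy volume μ + (1 - l) * diffEntropy volume ν
      - n * (l * Real.log (√l) + (1 - l) * Real.log (√(1 - l)))
      ≤ diffEntropy volume (Measure.conv μ ν) := by
  have hS : Measure.conv μ ν ≪ volume := Measure.conv_absolutelyContinuous hν
  obtain ⟨iμ, dμ, oμ⟩ := entropy_facts _ μ hμ eμ
  obtain ⟨iν, dν, oν⟩ := entropy_facts _ ν hν eν
  obtain ⟨iS, dS, oS⟩ := entropy_facts _ _ hS eS
  have pS : ∀ᵐ z ∂(Measure.conv μ ν), (Measure.conv μ ν).rnDeriv volume z ≠ 0 ∧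
      (Measure.conv μ ν).rnDeriv volume z ≠ ∞ := by
    filter_upwards [Measure.rnDeriv_pos hS, hS.ae_le (Measure.rnDeriv_lt_top (Measure.conv μ ν) volume)] with z h1 h2
    exact ⟨h1.ne', h2.ne⟩
  have mf : Measurable (μ.rnDeriv volume) := Measure.measurable_rnDeriv _ _
  have mh : Measurable (ν.rnDeriv volume) := Measure.measurable_rnDeriv _ _
  have mg : Measurable ((Measure.conv μ ν).rnDeriv volume) := Measure.measurable_rnDeriv _ _
  obtain ⟨T, U, J, K, ht, hu, hcov⟩ := hasTr_euclidean l hl0 hl1 n _ _ mf mh oμ oν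
  have mapT : Measure.map T (gamE n) = μ := by
    rw [ht.map_eq, Measure.withDensity_rnDeriv_eq _ _ hμ]
  have mapU : Measure.map U (gamE n) = ν := by
    rw [hu.map_eq, Measure.withDensity_rnDeriv_eq _ _ hν]
  have mS : Measurable fun p : EuclideanSpace ℝ (Fin n) × EuclideanSpace ℝ (Fin n) =>
      T p.1 + U p.2 := (ht.mT.comp measurable_fst).add (hu.mT.comp measurable_snd)
  have mapS : Measure.map (fun p : EuclideanSpace ℝ (Fin n) × EuclideanSpace ℝ (Fin n) =>
      T p.1 + U p.2) ((gamE n).prod (gamE n)) = Measure.conv μ ν := by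
    rw [Measure.conv, ← mapT, ← mapU, Measure.map_prod_map _ _ ht.mT hu.mT,
      Measure.map_map (by fun_prop) (ht.mT.prodMap hu.mT)]
    rfl
  set g := (Measure.conv μ ν).rnDeriv volume with hg
  set f := μ.rnDeriv volume with hf
  set h := ν.rnDeriv volume with hh
  have pS' : ∀ᵐ p ∂((gamE n).prod (gamE n)), g (T p.1 + U p.2) ≠ 0 ∧ g (T p.1 + U p.2) ≠ ∞ := by
    rw [← mapS] at pS
    exact ae_of_ae_map mS.aemeasurable pS
  have hcore := core l _ hl0 hl1 ht hu hcov mg oS pS'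
  have lm : ∀ {k : EuclideanSpace ℝ (Fin n) → ℝ≥0∞}, Measurable k →
      Measurable fun x => Real.log (k x).toReal := fun hk => hk.ennreal_toReal.log
  -- integrals
  have I1 : Integrable (fun p : EuclideanSpace ℝ (Fin n) × EuclideanSpace ℝ (Fin n) =>
      Real.log (g (T p.1 + U p.2)).toReal) ((gamE n).prod (gamE n)) := by
    have := iS
    rw [← mapS] at this
    exact this.comp_measurable mS
  have V1 : ∫ p, Real.log (g (T p.1 + U p.2)).toReal ∂((gamE n).prod (gamE n))
      = ∫ z, Real.log (g z).toReal ∂(Measure.conv μ ν) := by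
    conv_rhs => rw [← mapS]
    rw [integral_map mS.aemeasurable (lm mg).aestronglyMeasurable]
  have I2' : Integrable (fun x => Real.log (f (T x)).toReal) (gamE n) := by
    have := iμ
    rw [← mapT] at this
    exact this.comp_measurable ht.mT
  have V2 : ∫ x, Real.log (f (T x)).toReal ∂(gamE n) = ∫ z, Real.log (f z).toReal ∂μ := by
    conv_rhs => rw [← mapT]
    rw [integral_map ht.mT.aemeasurable (lm mf).aestronglyMeasurable]
  have I3' : Integrable (fun x => Real.log (h (U x)).toReal) (gamE n) := by
    have := iν
    rw [← mapU] at this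
    exact this.comp_measurable hu.mT
  have V3 : ∫ x, Real.log (h (U x)).toReal ∂(gamE n) = ∫ z, Real.log (h z).toReal ∂ν := by
    conv_rhs => rw [← mapU]
    rw [integral_map hu.mT.aemeasurable (lm mh).aestronglyMeasurable]
  have I2 : Integrable (fun p : EuclideanSpace ℝ (Fin n) × EuclideanSpace ℝ (Fin n) =>
      Real.log (f (T p.1)).toReal) ((gamE n).prod (gamE n)) := I2'.comp_fst _
  have I3 : Integrable (fun p : EuclideanSpace ℝ (Fin n) × EuclideanSpace ℝ (Fin n) =>
      Real.log (h (U p.2)).toReal) ((gamE n).prod (gamE n)) := I3'.comp_snd _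
  have W2 : ∫ p, Real.log (f (T p.1)).toReal ∂((gamE n).prod (gamE n))
      = ∫ x, Real.log (f (T x)).toReal ∂(gamE n) := by
    have := integral_fun_fst (μ := gamE n) (ν := gamE n) (fun x => Real.log (f (T x)).toReal)
    simpa using this
  have W3 : ∫ p, Real.log (h (U p.2)).toReal ∂((gamE n).prod (gamE n))
      = ∫ x, Real.log (h (U x)).toReal ∂(gamE n) := by
    have := integral_fun_snd (μ := gamE n) (ν := gamE n) (fun x => Real.log (h (U x)).toReal)
    simpa using this
  have hl1' : 0 < 1 - l := by linarith
  have sl : 0 < √l := Real.sqrt_pos.2 hl0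
  have sl' : 0 < √(1 - l) := Real.sqrt_pos.2 hl1'
  have hD : 0 < (√l ^ l * √(1 - l) ^ (1 - l)) ^ n := by positivity
  rw [← ENNReal.ofReal_pow (by positivity)] at hcore
  have I12 := I1.sub (I2.const_mul l)
  have I123 := I12.sub (I3.const_mul (1 - l))
  have I4 := (integrable_inner (n := n)).const_mul (2 * π * (√l * √(1 - l)))
  have key := log_bound _ _ (I123.add I4) _ hD hcore
  have ev := integral_add I123 I4
  have ev2 := integral_sub I12 (I3.const_mul (1 - l))
  have ev3 := integral_sub I1 (I2.const_mul l)
  simp only [Pi.sub_apply, Pi.add_apply] at key ev ev2 ev3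
  rw [ev3] at ev2
  rw [ev2] at ev
  rw [ev] at key
  rw [integral_const_mul, integral_const_mul, integral_const_mul, integral_inner, W2, W3, V1, V2,
    V3, Real.log_pow, Real.log_mul (by positivity) (by positivity), Real.log_rpow sl,
    Real.log_rpow sl'] at key
  rw [dμ, dν, dS]
  linarith

lemma epi_final (n : ℕ) (hn : 0 < n) (a b c : ℝ)
    (h : ∀ l : ℝ, 0 < l → l < 1 →
      l * a + (1 - l) * b - n * (l * Real.log (√l) + (1 - l) * Real.log (√(1 - l))) ≤ c) :
    Real.exp (2 * a / n) + Real.exp (2 * b / n) ≤ Real.exp (2 * c / n) := by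
  have hn' : (0 : ℝ) < n := by exact_mod_cast hn
  set A := Real.exp (2 * a / n) with hA
  set B := Real.exp (2 * b / n) with hB
  have A0 : 0 < A := Real.exp_pos _
  have B0 : 0 < B := Real.exp_pos _
  have hl0 : 0 < A / (A + B) := by positivity
  have e1 : 1 - A / (A + B) = B / (A + B) := by field_simp; ring
  have hl1 : A / (A + B) < 1 := by rw [div_lt_one (by positivity)]; linarith
  have := h _ hl0 hl1
  rw [e1, Real.log_sqrt (by positivity), Real.log_sqrt (by positivity),
    Real.log_div A0.ne' (by positivity), Real.log_div B0.ne' (by positivity)] at this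
  have lA : Real.log A = 2 * a / n := Real.log_exp _
  have lB : Real.log B = 2 * b / n := Real.log_exp _
  rw [lA, lB] at this
  have e2 : A / (A + B) * a + B / (A + B) * b
      - n * (A / (A + B) * ((2 * a / n - Real.log (A + B)) / 2)
        + B / (A + B) * ((2 * b / n - Real.log (A + B)) / 2))
      = n / 2 * Real.log (A + B) := by
    field_simp; ring
  rw [e2] at this
  rw [← Real.log_le_iff_le_exp (by positivity), le_div_iff₀ hn']
  linarith

end EPI

/-- The Entropy Power Inequality with classical conditioning. -/
theorem conditional_entropy_power_inequality
    {Ω : Type*} [MeasureSpace Ω] [IsProbabilityMeasure (ℙ : Measure Ω)] {n : ℕ} (hn : 0 < n)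
    {𝓜 : Type*} [Countable 𝓜] [MeasurableSpace 𝓜] [MeasurableSingletonClass 𝓜]
    (X Y : Ω → EuclideanSpace ℝ (Fin n)) (M : Ω → 𝓜)
    (hX : Measurable X) (hY : Measurable Y) (hM : Measurable M)
    -- conditioned on `M = m`, `X` and `Y` are independent:
    (hindep : ∀ m : 𝓜, ℙ (M ⁻¹' {m}) ≠ 0 → IndepFun X Y (ℙ[|M ⁻¹' {m}]))
    -- conditioned on `M = m`, `X`, `Y` and `X+Y` have probability densities and finite
    -- differential entropies:
    (hXac : ∀ m : 𝓜, ℙ (M ⁻¹' {m}) ≠ 0 → Measure.map X (ℙ[|M ⁻¹' {m}]) ≪ volume)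
    (hYac : ∀ m : 𝓜, ℙ (M ⁻¹' {m}) ≠ 0 → Measure.map Y (ℙ[|M ⁻¹' {m}]) ≪ volume)
    (hXent : ∀ m : 𝓜, ℙ (M ⁻¹' {m}) ≠ 0 →
      HasFiniteEntropy volume (Measure.map X (ℙ[|M ⁻¹' {m}])))
    (hYent : ∀ m : 𝓜, ℙ (M ⁻¹' {m}) ≠ 0 →
      HasFiniteEntropy volume (Measure.map Y (ℙ[|M ⁻¹' {m}])))
    (hSent : ∀ m : 𝓜, ℙ (M ⁻¹' {m}) ≠ 0 →
      HasFiniteEntropy volume (Measure.map (fun ω => X ω + Y ω) (ℙ[|M ⁻¹' {m}])))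
    -- the conditional entropies `S(X|M)`, `S(Y|M)`, `S(X+Y|M)` are finite:
    (hXsum : Summable fun m : 𝓜 =>
      (ℙ (M ⁻¹' {m})).toReal * diffEntropy volume (Measure.map X (ℙ[|M ⁻¹' {m}])))
    (hYsum : Summable fun m : 𝓜 =>
      (ℙ (M ⁻¹' {m})).toReal * diffEntropy volume (Measure.map Y (ℙ[|M ⁻¹' {m}])))
    (hSsum : Summable fun m : 𝓜 =>
      (ℙ (M ⁻¹' {m})).toReal
        * diffEntropy volume (Measure.map (fun ω => X ω + Y ω) (ℙ[|M ⁻¹' {m}]))) :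
    Real.exp (2 * condDiffEntropy (fun ω => X ω + Y ω) M / n)
      ≥ Real.exp (2 * condDiffEntropy X M / n) + Real.exp (2 * condDiffEntropy Y M / n) := by
  have hms : ∀ m : 𝓜, MeasurableSet (M ⁻¹' {m}) := fun m => hM (measurableSet_singleton m)
  have hq1 : ∑' m : 𝓜, ℙ (M ⁻¹' {m}) = 1 := by
    rw [← measure_iUnion (fun i j hij => ?_) hms]
    · have : (⋃ i, M ⁻¹' {i}) = Set.univ := by ext x; simp
      rw [this, measure_univ]
    · exact Disjoint.preimage M (by simpa using hij)
  have hq : HasSum (fun m : 𝓜 => (ℙ (M ⁻¹' {m})).toReal) 1 := by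
    have := ENNReal.hasSum_toReal (f := fun m : 𝓜 => ℙ (M ⁻¹' {m})) (by rw [hq1]; simp)
    rwa [← ENNReal.tsum_toReal_eq (fun m => measure_ne_top _ _), hq1, ENNReal.toReal_one] at this
  refine EPI.epi_final n hn _ _ _ fun l hl0 hl1 => ?_
  set R := (n : ℝ) * (l * Real.log (√l) + (1 - l) * Real.log (√(1 - l))) with hR
  have s1 := ((hXsum.hasSum.mul_left l).add (hYsum.hasSum.mul_left (1 - l))).sub (hq.mul_right R)
  have s2 := hSsum.hasSum
  have := hasSum_le (fun m => ?_) s1 s2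
  · rw [one_mul] at this
    exact this
  · by_cases hm : ℙ (M ⁻¹' {m}) = 0
    · simp [hm]
    · have : IsProbabilityMeasure (ℙ[|M ⁻¹' {m}]) := cond_isProbabilityMeasure hm
      have p1 : IsProbabilityMeasure (Measure.map X (ℙ[|M ⁻¹' {m}])) :=
        Measure.isProbabilityMeasure_map hX.aemeasurable
      have p2 : IsProbabilityMeasure (Measure.map Y (ℙ[|M ⁻¹' {m}])) :=
        Measure.isProbabilityMeasure_map hY.aemeasurable
      have hc : Measure.map (fun ω => X ω + Y ω) (ℙ[|M ⁻¹' {m}])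
          = Measure.conv (Measure.map X (ℙ[|M ⁻¹' {m}])) (Measure.map Y (ℙ[|M ⁻¹' {m}])) :=
        (hindep m hm).map_add_eq_map_conv_map₀ hX.aemeasurable hY.aemeasurable
      have eS := hSent m hm
      rw [hc] at eS ⊢
      have := EPI.epi_lin l hl0 hl1 _ _ (hXac m hm) (hYac m hm) (hXent m hm) (hYent m hm) eS
      have h2 := mul_le_mul_of_nonneg_left this (ENNReal.toReal_nonneg (a := ℙ (M ⁻¹' {m})))
      refine le_trans (le_of_eq ?_) h2
      rw [hR]; ring

end
end
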